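/- Let Q and Q' be finite acyclic quivers. If there is a poset isomorphism between the support τ-tilting posets sτtilt KQ and sτtilt KQ' (which, for hereditary algebras, coincide with the support tilting posets), then the decorated quivers Q_dec and Q'_dec are isomorphic. -/

import Mathlib

/-!
Common framework for formalizing statements from
"From support τ-tilting posets to algebras" (R. Kase).

Modules over the basic finite dimensional algebra `Λ` are taken to be *right*
modules, encoded as (left) modules over the opposite ring `Λᵐᵒᵖ`.
τ-rigidity is encoded through the Auslander–Smalø criterion:
`Hom(M, τM) = 0` iff `Ext¹(M, Fac M) = 0`, and the vanishing of `Ext¹(M, X)`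
is encoded by the splitting of all short exact sequences `0 → X → E → M → 0`.
-/

open MulOpposite

namespace TauTilting

/-- Bundled modules over `A` (in `Type 0`). -/
abbrev Mdl (A : Type) [Ring A] := ModuleCat.{0} A

variable {A B : Type} [Ring A] [Ring B]

/-- `X ∈ Fac M` : `X` is a factor of a finite direct sum of copies of `M`. -/
def MemFac (M X : Mdl A) : Prop :=
  ∃ (n : ℕ) (f : (Fin n → M) →ₗ[A] X), Function.Surjective f

/-- Every short exact sequence `0 → X → E → M → 0` splits, i.e. `Ext¹(M, X) = 0`. -/
def Ext1Vanish (M X : Mdl A) : Prop :=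
  ∀ (E : Mdl A) (f : X →ₗ[A] E) (g : E →ₗ[A] M),
    Function.Injective f → Function.Surjective g →
    LinearMap.range f = LinearMap.ker g →
    ∃ s : M →ₗ[A] E, g.comp s = LinearMap.id

/-- `M` is τ-rigid (Auslander–Smalø: `Hom(M, τM) = 0 ↔ Ext¹(M, Fac M) = 0`). -/
def IsTauRigid (M : Mdl A) : Prop :=
  Module.Finite A M ∧ ∀ X : Mdl A, MemFac M X → Ext1Vanish M X

/-- `M` is indecomposable. -/
def IsIndec (M : Mdl A) : Prop :=
  Nontrivial M ∧ ∀ N N' : Submodule A M, IsCompl N N' → N = ⊥ ∨ N' = ⊥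

/-- `F` is an (internal) decomposition of `M` into indecomposable direct summands. -/
def IsDecompOf (M : Mdl A) {n : ℕ} (F : Fin n → Submodule A M) : Prop :=
  iSupIndep F ∧ iSup F = ⊤ ∧ ∀ k, IsIndec (ModuleCat.of A (F k))

/-- `|M| = n` : `M` decomposes into `n` indecomposable direct summands. -/
def HasNumSummands (M : Mdl A) (n : ℕ) : Prop :=
  ∃ F : Fin n → Submodule A M, IsDecompOf M F

/-- `M` is basic: its indecomposable direct summands are pairwise non-isomorphic. -/
def IsBasicMod (M : Mdl A) : Prop :=
  ∃ (n : ℕ) (F : Fin n → Submodule A M), IsDecompOf M F ∧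
    ∀ k l : Fin n, k ≠ l → IsEmpty (↥(F k) ≃ₗ[A] ↥(F l))

def ModIso (M N : Mdl A) : Prop := Nonempty (M ≃ₗ[A] N)

/-- The order on support τ-tilting modules: `M ≤ N ↔ Fac M ⊆ Fac N`. -/
def FacLE (M N : Mdl A) : Prop := ∀ X : Mdl A, MemFac M X → MemFac N X
def FacLT (M N : Mdl A) : Prop := FacLE M N ∧ ¬ FacLE N M
/-- Equality in the poset of iso-classes: mutual `≤`. -/
def PE (M N : Mdl A) : Prop := FacLE M N ∧ FacLE N M

/-- `N` is a direct summand of `M`. -/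
def IsSummand (N M : Mdl A) : Prop :=
  ∃ (f : N →ₗ[A] M) (g : M →ₗ[A] N), g.comp f = LinearMap.id
/-- `N ∈ add M`. -/
def InAdd (N M : Mdl A) : Prop := ∃ n : ℕ, IsSummand N (ModuleCat.of A (Fin n → M))
def HomZero (R M : Mdl A) : Prop := ∀ f : R →ₗ[A] M, f = 0

/-- Direct sum of two bundled modules. -/
def dsum (M N : Mdl A) : Mdl A := ModuleCat.of A (M × N)

/-- Hasse-quiver arrow `M → N` (so `N` is a direct successor of `M`, and `M` a
direct predecessor of `N`) in the poset of all modules satisfying `P`,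
ordered by `FacLE`. -/
def HArrow (P : Mdl A → Prop) (M N : Mdl A) : Prop :=
  P M ∧ P N ∧ FacLT N M ∧ ∀ C, P C → FacLT N C → FacLT C M → False

def IsMaxOf (P : Mdl A → Prop) (T : Mdl A) : Prop := P T ∧ ∀ S, P S → FacLE S T
def IsMinOf (P : Mdl A → Prop) (T : Mdl A) : Prop := P T ∧ ∀ S, P S → FacLE T S

/-- `T` has exactly `n` direct successors (counted up to poset equality). -/
def SuccsCard (P : Mdl A → Prop) (T : Mdl A) (n : ℕ) : Prop :=
  ∃ g : Fin n → Mdl A, (∀ k, HArrow P T (g k)) ∧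
    (∀ k l, k ≠ l → ¬ PE (g k) (g l)) ∧ ∀ S, HArrow P T S → ∃ k, PE S (g k)

/-- `T` has exactly `n` direct predecessors (counted up to poset equality). -/
def PredsCard (P : Mdl A → Prop) (T : Mdl A) (n : ℕ) : Prop :=
  ∃ g : Fin n → Mdl A, (∀ k, HArrow P (g k) T) ∧
    (∀ k l, k ≠ l → ¬ PE (g k) (g l)) ∧ ∀ S, HArrow P S T → ∃ k, PE S (g k)

/-- The poset of modules satisfying `P` (ordered by `FacLE`) is a lattice. -/
def IsLatticeP (P : Mdl A → Prop) : Prop :=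
  ∀ M N, P M → P N →
    (∃ J, P J ∧ FacLE M J ∧ FacLE N J ∧ ∀ C, P C → FacLE M C → FacLE N C → FacLE J C) ∧
    (∃ W, P W ∧ FacLE W M ∧ FacLE W N ∧ ∀ C, P C → FacLE C M → FacLE C N → FacLE C W)

/-- A poset isomorphism between the posets (of isomorphism classes) of modules
satisfying `PA` resp. `PB`, ordered by `FacLE`. -/
structure PosetIsoP (PA : Mdl A → Prop) (PB : Mdl B → Prop) where
  toFun : Mdl A → Mdl B
  invFun : Mdl B → Mdl A
  maps : ∀ M, PA M → PB (toFun M)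
  maps' : ∀ N, PB N → PA (invFun N)
  le_iff : ∀ M N, PA M → PA N → (FacLE M N ↔ FacLE (toFun M) (toFun N))
  le_iff' : ∀ M N, PB M → PB N → (FacLE M N ↔ FacLE (invFun M) (invFun N))
  left_inv : ∀ M, PA M → PE (invFun (toFun M)) M
  right_inv : ∀ N, PB N → PE (toFun (invFun N)) N

/-- A poset isomorphism between the poset of modules satisfying `P` and an
abstract poset `(β, le)`. -/
structure PosetIsoTo (P : Mdl A → Prop) (β : Type) (le : β → β → Prop) where
  toFun : Mdl A → β
  invFun : β → Mdl A
  maps' : ∀ b, P (invFun b)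
  le_iff : ∀ M N, P M → P N → (FacLE M N ↔ le (toFun M) (toFun N))
  left_inv : ∀ M, P M → PE (invFun (toFun M)) M
  right_inv : ∀ b, toFun (invFun b) = b

/-! ### Ring-level notions -/

variable (Λ : Type) [Ring Λ]

/-- The right ideal generated by a subset, as a right module (i.e. `Λᵐᵒᵖ`-module). -/
def rSpan (S : Set Λ) : Submodule Λᵐᵒᵖ Λ := Submodule.span Λᵐᵒᵖ S
/-- The two-sided ideal `(q) = ΛqΛ`, as a right `Λ`-module. -/
def tIdeal (q : Λ) : Submodule Λᵐᵒᵖ Λ := Submodule.span Λᵐᵒᵖ {y : Λ | ∃ a : Λ, y = a * q}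
/-- The right `Λ`-module `Λ/S`. -/
def quotMod (S : Submodule Λᵐᵒᵖ Λ) : Mdl Λᵐᵒᵖ := ModuleCat.of Λᵐᵒᵖ (Λ ⧸ S)
/-- `Λ` as a right module over itself. -/
def regMod : Mdl Λᵐᵒᵖ := ModuleCat.of Λᵐᵒᵖ Λ
/-- The projective right module `xΛ ≅ Λ/(1-x)Λ` attached to an idempotent `x`. -/
def projMod (x : Λ) : Mdl Λᵐᵒᵖ := quotMod Λ (rSpan Λ {1 - x})
/-- The right `Λ`-module `Λ/(1-x)`; for `x = e i` this is the module `X_i`. -/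
def cyclicQuot (x : Λ) : Mdl Λᵐᵒᵖ := quotMod Λ (tIdeal Λ (1 - x))

/-- `x` is a primitive idempotent. -/
def IsPrimIdem (x : Λ) : Prop :=
  IsIdempotentElem x ∧ x ≠ 0 ∧
    ∀ a b : Λ, IsIdempotentElem a → IsIdempotentElem b →
      a * b = 0 → b * a = 0 → a + b = x → a = 0 ∨ b = 0

variable {ι : Type} [Fintype ι]

/-- `e` is a complete family of orthogonal primitive idempotents of `Λ`. -/
def CompletePrimIdems (e : ι → Λ) : Prop :=
  (∀ i, IsPrimIdem Λ (e i)) ∧ (Pairwise fun i j => e i * e j = 0) ∧ ∑ i, e i = 1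

/-- `Λ` is basic w.r.t. `e`: the `e i Λ` are pairwise non-isomorphic. -/
def IsBasicAlg (e : ι → Λ) : Prop :=
  ∀ i j : ι, i ≠ j → IsEmpty (↥(projMod Λ (e i)) ≃ₗ[Λᵐᵒᵖ] ↥(projMod Λ (e j)))

/-- The support `supp(M) = {i | M·eᵢ ≠ 0}` of a right module `M`. -/
def Supp (e : ι → Λ) (M : Mdl Λᵐᵒᵖ) : Set ι := {i | ∃ m : M, op (e i) • m ≠ 0}

/-- Support τ-tilting module: τ-rigid with `|M| = #supp(M)`. -/
def IsSTT (e : ι → Λ) (M : Mdl Λᵐᵒᵖ) : Prop :=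
  Module.Finite Λᵐᵒᵖ M ∧ IsTauRigid M ∧ HasNumSummands M (Supp Λ e M).ncard

/-- Basic support τ-tilting module. -/
def IsBSTT (e : ι → Λ) (M : Mdl Λᵐᵒᵖ) : Prop := IsSTT Λ e M ∧ IsBasicMod M

/-- τ-tilting module: τ-rigid with `|M| = #Q₀`. -/
def IsTauTiltingMod (e : ι → Λ) (M : Mdl Λᵐᵒᵖ) : Prop :=
  IsSTT Λ e M ∧ HasNumSummands M (Fintype.card ι)

open scoped Classical in
/-- The idempotent `1 - e_M = Σ_{i ∉ supp M} e i`. -/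
noncomputable def cIdem (e : ι → Λ) (M : Mdl Λᵐᵒᵖ) : Λ :=
  ∑ i : ι, if i ∈ Supp Λ e M then 0 else e i

/-- τ-rigid pair `(M, P)`. -/
def IsTauRigidPair (e : ι → Λ) (M P : Mdl Λᵐᵒᵖ) : Prop :=
  IsTauRigid M ∧ Module.Finite Λᵐᵒᵖ P ∧ Module.Projective Λᵐᵒᵖ P ∧
    InAdd P (projMod Λ (cIdem Λ e M))

/-- Basic τ-rigid pair. -/
def IsBasicTRP (e : ι → Λ) (M P : Mdl Λᵐᵒᵖ) : Prop :=
  IsTauRigidPair Λ e M P ∧ IsBasicMod M ∧ IsBasicMod P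

/-- `T ∈ sτtilt_{(N,R)} Λ`, i.e. `N ∈ add T` and `Hom(R, T) = 0`. -/
def InPairSet (N R T : Mdl Λᵐᵒᵖ) : Prop := InAdd N T ∧ HomZero R T

/-- `Λ` is τ-tilting finite: finitely many basic support τ-tilting modules up to iso. -/
def TauTiltingFinite (e : ι → Λ) : Prop :=
  ∃ (n : ℕ) (T : Fin n → Mdl Λᵐᵒᵖ), ∀ M, IsBSTT Λ e M → ∃ k, ModIso M (T k)

/-- The Jacobson radical of `Λ`, as a `K`-subspace. -/
noncomputable def radK (K : Type) [CommRing K] (Λ : Type) [Ring Λ] [Algebra K Λ] :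
    Submodule K Λ :=
  Submodule.restrictScalars K (sInf {I : Ideal Λ | I.IsMaximal})

/-- Powers of the radical, with `rad⁰ = Λ`. -/
noncomputable def radPow (K : Type) [CommRing K] (Λ : Type) [Ring Λ] [Algebra K Λ] :
    ℕ → Submodule K Λ
  | 0 => ⊤
  | n + 1 => radK K Λ ^ (n + 1)

/-! ### Quivers, paths and presentations -/

/-- Paths in a quiver with vertex set `ι` and arrow types `Arr i j`. -/
inductive QPath {ι : Type} (Arr : ι → ι → Type) : ι → ι → Type
  | nil (i : ι) : QPath Arr i i
  | cons {i j k : ι} (a : Arr i j) (p : QPath Arr j k) : QPath Arr i k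

namespace QPath

variable {ι : Type} {Arr : ι → ι → Type}

/-- The list of visited vertices. -/
def verts : ∀ {i j : ι}, QPath Arr i j → List ι
  | i, _, .nil _ => [i]
  | i, _, .cons _ p => i :: p.verts

/-- Evaluation of a path in the algebra `Λ` (trivial path at `i` ↦ `e i`). -/
def eval {Λ : Type} [Ring Λ] (e : ι → Λ) (arr : ∀ i j, Arr i j → Λ) :
    ∀ {i j : ι}, QPath Arr i j → Λ
  | _, _, .nil i => e i
  | _, _, .cons a p => arr _ _ a * p.eval e arr

def append : ∀ {i j k : ι}, QPath Arr i j → QPath Arr j k → QPath Arr i k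
  | _, _, _, .nil _, q => q
  | _, _, _, .cons a p, q => .cons a (p.append q)

def single {i j : ι} (a : Arr i j) : QPath Arr i j := .cons a (.nil j)

end QPath

/-- The condition `xΛe_j = e_iΛe_j = e_iΛx ≠ 0` on an element `x` of `e_iΛe_j`. -/
def Gcond (ei ej x : Λ) : Prop :=
  (Set.range fun b => x * b * ej) = (Set.range fun b => ei * b * ej) ∧
  (Set.range fun b => ei * b * x) = (Set.range fun b => ei * b * ej) ∧
  ∃ b, ei * b * ej ≠ 0

/-- `w ∈ G(Q, I)` : `w` contains no cycle as a subpath (equivalently, visits no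
vertex twice) and `wΛe_j = e_iΛe_j = e_iΛw ≠ 0`. -/
def GMem (e : ι → Λ) {Arr : ι → ι → Type} (arr : ∀ i j, Arr i j → Λ) {i j : ι}
    (w : QPath Arr i j) : Prop :=
  w.verts.Nodup ∧ Gcond Λ (e i) (e j) (w.eval e arr)

/-- Condition 1 for a bound quiver: if `e_iΛe_j ≠ 0` then `G^i_j ≠ ∅`. -/
def Cond1 (e : ι → Λ) {Arr : ι → ι → Type} (arr : ∀ i j, Arr i j → Λ) : Prop :=
  ∀ i j : ι, (∃ x, e i * x * e j ≠ 0) → ∃ w : QPath Arr i j, GMem Λ e arr w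

/-- Ring-level version of Condition 1 (Lemma `eqcd` (iii)). -/
def Cond1R : Prop :=
  ∀ x y : Λ, IsPrimIdem Λ x → IsPrimIdem Λ y → x * y = 0 → y * x = 0 →
    ∃ w : Λ, (∃ b, w = x * b * y) ∧
      (Set.range fun b => w * b * y) = (Set.range fun b => x * b * y) ∧
      (Set.range fun b => x * b * w) = (Set.range fun b => x * b * y)

/-- `(e, Arr, arr)` presents `Λ` as the bound quiver algebra `KQ/I` with `Q` its
Gabriel quiver: `e` is a complete family of orthogonal primitive idempotents,
`Λ` is basic, each arrow `a : i → j` is sent to an element of `e_i (rad Λ) e_j`,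
and the arrows form a `K`-basis of `rad Λ / rad² Λ`. -/
def IsGabrielPres (K : Type) [Field K] [Algebra K Λ] [DecidableEq ι] (e : ι → Λ)
    (Arr : ι → ι → Type) [∀ i j, Fintype (Arr i j)] (arr : ∀ i j, Arr i j → Λ) : Prop :=
  CompletePrimIdems Λ e ∧ IsBasicAlg Λ e ∧
  (∀ i j (a : Arr i j), arr i j a ∈ radK K Λ ∧ e i * arr i j a * e j = arr i j a) ∧
  (radK K Λ ≤
    Submodule.span K (Set.range fun p : Σ i : ι, Σ j : ι, Arr i j => arr p.1 p.2.1 p.2.2) ⊔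
      radK K Λ * radK K Λ) ∧
  (∀ c : (Σ i : ι, Σ j : ι, Arr i j) → K,
    (∑ p : Σ i : ι, Σ j : ι, Arr i j, c p • arr p.1 p.2.1 p.2.2) ∈ radK K Λ * radK K Λ →
    ∀ p, c p = 0)

/-! ### Partitions of a quiver, Condition 2 -/

/-- `x` and `y` are adjacent within the vertex subset `S` (undirected). -/
def AdjIn {ι : Type} (Arr : ι → ι → Type) (S : Set ι) (x y : ι) : Prop :=
  x ∈ S ∧ y ∈ S ∧ (Nonempty (Arr x y) ∨ Nonempty (Arr y x))

/-- The full subquiver on `S` is connected. -/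
def ConnectedOn {ι : Type} (Arr : ι → ι → Type) (S : Set ι) : Prop :=
  ∀ x ∈ S, ∀ y ∈ S, Relation.ReflTransGen (AdjIn Arr S) x y

/-- Adjacency of parts in the quotient quiver `Q^μ`. -/
def PartAdj {ι : Type} (Arr : ι → ι → Type) {ℓ : ℕ} (μ : ι → Fin ℓ) (u v : Fin ℓ) : Prop :=
  u ≠ v ∧ ∃ x y, μ x = u ∧ μ y = v ∧ (Nonempty (Arr x y) ∨ Nonempty (Arr y x))

/-- Condition 2: there is a partition `μ` of `Q₀` into connected full subquivers
such that `Q^μ` is a tree (connected with `#arrows = #parts - 1`) and each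
`sτtilt Λ^{a,b}_μ` — identified with the subposet of `sτtilt Λ` of modules
supported on the union of the two parts — is a lattice. -/
def Cond2 (e : ι → Λ) (Arr : ι → ι → Type) [∀ i j, Fintype (Arr i j)] : Prop :=
  ∃ (ℓ : ℕ) (μ : ι → Fin ℓ), Function.Surjective μ ∧
    (∀ a : Fin ℓ, ConnectedOn Arr {i | μ i = a}) ∧
    (∀ u v : Fin ℓ, Relation.ReflTransGen (PartAdj Arr μ) u v) ∧
    Nat.card {p : Σ i : ι, Σ j : ι, Arr i j // μ p.1 ≠ μ p.2.1} = ℓ - 1 ∧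
    ∀ a b : Fin ℓ, a ≠ b →
      IsLatticeP (fun T : Mdl Λᵐᵒᵖ => IsBSTT Λ e T ∧ Supp Λ e T ⊆ {i | μ i = a ∨ μ i = b})

/-! ### Correspondence of paths under a quiver isomorphism, and `∼` -/

/-- Transport of paths along a quiver isomorphism `σ : Q° → (Q')°` (defined on
non-loop arrows). -/
inductive PathCorr {ι ι' : Type} {Arr : ι → ι → Type} {Arr' : ι' → ι' → Type}
    (σ : ι → ι') (σ1 : ∀ i j, i ≠ j → Arr i j → Arr' (σ i) (σ j)) :
    ∀ {i j : ι}, QPath Arr i j → QPath Arr' (σ i) (σ j) → Prop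
  | nil (i : ι) : PathCorr σ σ1 (QPath.nil i) (QPath.nil (σ i))
  | cons {i j k : ι} (h : i ≠ j) (a : Arr i j) {p : QPath Arr j k}
      {p' : QPath Arr' (σ j) (σ k)} :
      PathCorr σ σ1 p p' → PathCorr σ σ1 (QPath.cons a p) (QPath.cons (σ1 i j h a) p')

/-- The relation `(Q, I) ∼ (Q', I')`: there is a quiver isomorphism
`σ : Q° → (Q')°` with (a) `supp(e_{σ(i)}Γ) = σ(supp(e_iΛ))` and (b) `G(Γ) = σ(G(Λ))`. -/
def SimCond {Λ Γ : Type} [Ring Λ] [Ring Γ] {ι ι' : Type}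
    (e : ι → Λ) {Arr : ι → ι → Type} (arr : ∀ i j, Arr i j → Λ)
    (f : ι' → Γ) {Arr' : ι' → ι' → Type} (arr' : ∀ i j, Arr' i j → Γ) : Prop :=
  ∃ (σ : ι ≃ ι') (σ1 : ∀ i j, i ≠ j → (Arr i j ≃ Arr' (σ i) (σ j))),
    (∀ i j : ι, (∃ x, e i * x * e j ≠ 0) ↔ ∃ y, f (σ i) * y * f (σ j) ≠ 0) ∧
    (∀ (i j : ι) (w : QPath Arr i j), GMem Λ e arr w →
      ∃ w' : QPath Arr' (σ i) (σ j),
        PathCorr σ (fun i j h => σ1 i j h) w w' ∧ GMem Γ f arr' w') ∧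
    (∀ (i j : ι) (w' : QPath Arr' (σ i) (σ j)), GMem Γ f arr' w' →
      ∃ w : QPath Arr i j,
        PathCorr σ (fun i j h => σ1 i j h) w w' ∧ GMem Λ e arr w)

end TauTilting

namespace TauTilting

set_option linter.unusedSectionVars false

section Ring

variable {K : Type} [Field K] {Λ : Type} [Ring Λ] [Algebra K Λ]

variable (K Λ) in
theorem radK_mem_iff (x : Λ) : x ∈ radK K Λ ↔ ∀ I : Ideal Λ, I.IsMaximal → x ∈ I := by
  simp [radK, Submodule.mem_sInf]

variable (K Λ) in
theorem radK_eq : radK K Λ = (Ideal.jacobson (⊥ : Ideal Λ)).restrictScalars K := by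
  ext x
  simp [radK_mem_iff, Ideal.jacobson, Submodule.mem_sInf]

theorem radK_mul_mem_left (a : Λ) {x : Λ} (hx : x ∈ radK K Λ) : a * x ∈ radK K Λ := by
  rw [radK_eq] at hx ⊢
  exact Ideal.mul_mem_left (Ideal.jacobson ⊥) a hx

theorem radK_mul_mem_right (a : Λ) {x : Λ} (hx : x ∈ radK K Λ) : x * a ∈ radK K Λ := by
  rw [radK_eq] at hx ⊢
  exact Ideal.mul_mem_right a (Ideal.jacobson ⊥) hx

theorem radSq_mul_mem_left (a : Λ) {x : Λ} (hx : x ∈ radK K Λ * radK K Λ) :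
    a * x ∈ radK K Λ * radK K Λ := by
  refine Submodule.mul_induction_on hx (fun m hm n hn => ?_) (fun x y hx hy => ?_)
  · rw [← mul_assoc]; exact Submodule.mul_mem_mul (radK_mul_mem_left a hm) hn
  · rw [mul_add]; exact add_mem hx hy

theorem radSq_mul_mem_right (a : Λ) {x : Λ} (hx : x ∈ radK K Λ * radK K Λ) :
    x * a ∈ radK K Λ * radK K Λ := by
  refine Submodule.mul_induction_on hx (fun m hm n hn => ?_) (fun x y hx hy => ?_)
  · rw [mul_assoc]; exact Submodule.mul_mem_mul hm (radK_mul_mem_right a hn)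
  · rw [add_mul]; exact add_mem hx hy

variable (K Λ) in
theorem radSq_le : radK K Λ * radK K Λ ≤ radK K Λ :=
  Submodule.mul_le.2 fun m _ _ hn => radK_mul_mem_left m hn

/-- Left multiplication by `v = e' v e` as a map `eΛ → e'Λ` of projective right modules. -/
noncomputable def projMap {e e' : Λ} (v : Λ) (hv : v * e = v) :
    (projMod Λ e : Mdl Λᵐᵒᵖ) →ₗ[Λᵐᵒᵖ] (projMod Λ e' : Mdl Λᵐᵒᵖ) :=
  Submodule.mapQ _ _ ({ toFun := fun x => v * x
                        map_add' := mul_add v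
                        map_smul' := fun a x => by
                          simp [MulOpposite.smul_eq_mul_unop, mul_assoc] } : Λ →ₗ[Λᵐᵒᵖ] Λ) (by
    rw [rSpan, Submodule.span_le]
    rintro _ rfl
    simp [mul_sub, hv])

theorem projMod_equiv {e e' u v : Λ} (hv : v * e = v)
    (hu : u * e' = u) (huv : u * v = e) (hvu : v * u = e') :
    Nonempty (↥(projMod Λ e) ≃ₗ[Λᵐᵒᵖ] ↥(projMod Λ e')) := by
  have key : ∀ (e : Λ) (x : Λ), (Submodule.Quotient.mk (e * x) :
      Λ ⧸ rSpan Λ {1 - e}) = Submodule.Quotient.mk x := by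
    intro e x
    rw [eq_comm, Submodule.Quotient.eq]
    have : x - e * x = op x • (1 - e) := by
      rw [MulOpposite.smul_eq_mul_unop, unop_op, sub_mul, one_mul]
    rw [this]
    exact Submodule.smul_mem _ _ (Submodule.subset_span rfl)
  refine ⟨LinearEquiv.ofLinearMap (projMap v hv) (projMap u hu) ?_ ?_⟩
  · refine LinearMap.ext fun x => ?_
    induction x using Submodule.Quotient.induction_on with
    | _ x =>
    change (Submodule.Quotient.mk (v * (u * x)) : Λ ⧸ rSpan Λ {1 - e'}) = _
    rw [← mul_assoc, hvu, key]; rfl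
  · refine LinearMap.ext fun x => ?_
    induction x using Submodule.Quotient.induction_on with
    | _ x =>
    change (Submodule.Quotient.mk (u * (v * x)) : Λ ⧸ rSpan Λ {1 - e}) = _
    rw [← mul_assoc, huv, key]; rfl

/-- An element outside a maximal left ideal is not killed in the simple quotient. -/
theorem exists_corner_fix {I : Ideal Λ} (hI : I.IsMaximal) {e y : Λ} (hy : y * e = y)
    (hyI : y ∉ I) : ∃ z : Λ, (z * y - 1) * e ∈ I ∧ e ∉ I := by
  have h1 : I ⊔ Ideal.span {y} = ⊤ := by
    refine hI.1.2 _ (lt_of_le_of_ne le_sup_left fun h => hyI ?_)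
    rw [h]; exact Ideal.mem_sup_right (Ideal.mem_span_singleton_self y)
  have h2 : e ∈ I ⊔ Ideal.span {y} := by rw [h1]; trivial
  obtain ⟨a, ha, b, hb, hab⟩ := Submodule.mem_sup.1 h2
  obtain ⟨z, rfl⟩ := Ideal.mem_span_singleton'.1 hb
  refine ⟨z, ?_, fun he => hyI (hy ▸ I.mul_mem_left y he)⟩
  have : (z * y - 1) * e = - a := by
    rw [sub_mul, one_mul, mul_assoc, hy, ← hab]; abel
  rw [this]; exact neg_mem ha

variable [FiniteDimensional K Λ]

open Polynomial in
theorem exists_fitting_idempotent (K : Type) [Field K] {Λ : Type} [Ring Λ] [Algebra K Λ]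
    [FiniteDimensional K Λ] (t : Λ) :
    ∃ (r : ℕ) (u : Λ), Commute u t ∧ IsIdempotentElem (u * t ^ (r + 1)) ∧
      t ^ (r + 1) * (u * t ^ (r + 1)) = t ^ (r + 1) := by
  have hint : IsIntegral K t := IsIntegral.of_finite K t
  obtain ⟨n, q, hq, hp⟩ := WfDvdMonoid.max_power_factor (minpoly.ne_zero hint)
    (irreducible_X (R := K))
  have hco : IsCoprime (X ^ (n + 1) : K[X]) q :=
    IsCoprime.pow_left ((irreducible_X (R := K)).coprime_iff_not_dvd.2 hq)
  obtain ⟨a, b, hab⟩ := hco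
  have hz : aeval t (X ^ (n + 1) * q) = 0 := by
    have : (X ^ (n + 1) * q : K[X]) = X * minpoly K t := by rw [hp]; ring
    rw [this, map_mul, minpoly.aeval, mul_zero]
  have hX : t ^ (n + 1) = aeval t (X ^ (n + 1) : K[X]) := by simp
  refine ⟨n, aeval t a, ?_, ?_, ?_⟩
  · have h := Commute.all a (X : K[X])
    simpa using h.map (aeval (R := K) t)
  · have : (a * X ^ (n + 1)) * (a * X ^ (n + 1)) =
        a * X ^ (n + 1) - (a * b) * (X ^ (n + 1) * q) := by
      linear_combination (a * X ^ (n + 1)) * hab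
    rw [IsIdempotentElem, hX, ← map_mul, ← map_mul, this, map_sub, map_mul _ (a * b), hz]
    simp
  · have : X ^ (n + 1) * (a * X ^ (n + 1)) = X ^ (n + 1) - b * (X ^ (n + 1) * q) := by
      linear_combination (X ^ (n + 1)) * hab
    rw [hX, ← map_mul, ← map_mul, this, map_sub, map_mul _ b, hz]
    simp

/-- Corners at primitive idempotents are local: an element is nilpotent or left invertible. -/
theorem IsPrimIdem.isNilpotent_or_exists_mul_eq (K : Type) [Field K] {Λ : Type} [Ring Λ]
    [Algebra K Λ] [FiniteDimensional K Λ] {e t : Λ} (he : IsPrimIdem Λ e) (h1 : e * t = t)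
    (h2 : t * e = t) : IsNilpotent t ∨ ∃ v : Λ, e * v = v ∧ v * e = v ∧ v * t = e := by
  obtain ⟨r, u, hu, hi, ht⟩ := exists_fitting_idempotent K t
  set f := u * t ^ (r + 1) with hf
  have hf1 : f * e = f := by
    rw [hf, pow_succ, mul_assoc, mul_assoc, h2]
  have hf2 : e * f = f := by
    have : f = t ^ (r + 1) * u := (hu.pow_right _).eq
    rw [this, ← mul_assoc, pow_succ', ← mul_assoc e, h1]
  have key := he.2.2 f (e - f) hi
    (by rw [IsIdempotentElem, mul_sub, sub_mul, sub_mul, he.1.eq, hf1, hf2, hi.eq]; abel)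
    (by rw [mul_sub, hf1, hi.eq, sub_self]) (by rw [sub_mul, hf2, hi.eq, sub_self]) (by abel)
  rcases key with h | h
  · left
    exact ⟨r + 1, by rw [← ht, h, mul_zero]⟩
  · right
    have hfe : f = e := (sub_eq_zero.1 h).symm
    refine ⟨e * (u * t ^ r) * e, ?_, ?_, ?_⟩
    · rw [← mul_assoc, ← mul_assoc, he.1.eq]
    · rw [mul_assoc _ e e, he.1.eq]
    · rw [mul_assoc, h1, mul_assoc, mul_assoc, ← pow_succ, ← hf, hf2, hfe]

theorem IsPrimIdem.exists_isNilpotent_sub [IsAlgClosed K] {e w : Λ} (he : IsPrimIdem Λ e)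
    (h1 : e * w = w) (h2 : w * e = w) : ∃ c : K, IsNilpotent (w - c • e) := by
  let W : Submodule K Λ := LinearMap.range (LinearMap.mulLeft K e)
  have hW : ∀ x ∈ W, e * x = x := by
    rintro _ ⟨y, rfl⟩
    simp [← mul_assoc, he.1.eq]
  have heW : e ∈ W := ⟨e, he.1.eq⟩
  have : Nontrivial W := ⟨⟨⟨e, heW⟩, 0, fun h => he.2.1 (congrArg Subtype.val h)⟩⟩
  let L : Module.End K W := (LinearMap.mulLeft K w).restrict (p := W) (q := W)
    (fun x _ => ⟨w * x, by simp [← mul_assoc, h1]⟩)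
  obtain ⟨c, hc⟩ := Module.End.exists_eigenvalue L
  obtain ⟨x, hx⟩ := hc.exists_hasEigenvector
  have hx1 : w * (x : Λ) = c • (x : Λ) := congrArg Subtype.val hx.apply_eq_smul
  refine ⟨c, ?_⟩
  rcases he.isNilpotent_or_exists_mul_eq K (t := w - c • e)
    (by rw [mul_sub, h1, mul_smul_comm, he.1.eq])
    (by rw [sub_mul, h2, smul_mul_assoc, he.1.eq]) with h | ⟨v, -, -, hv⟩
  · exact h
  · exfalso
    apply hx.2
    apply Subtype.ext
    have : v * (w - c • e) * (x : Λ) = 0 := by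
      rw [mul_assoc, sub_mul, hx1, smul_mul_assoc, hW x x.2, sub_self, mul_zero]
    rwa [hv, hW x x.2] at this

variable (K Λ) in
theorem radK_pow_eq_bot : ∃ n : ℕ, radK K Λ ^ n = ⊥ := by
  have : IsArtinianRing Λ := IsArtinianRing.of_finite K Λ
  obtain ⟨n, hn⟩ := IsArtinianRing.isNilpotent_jacobson_bot (R := Λ)
  have : ∀ m : ℕ, m ≠ 0 → ∀ x ∈ radK K Λ ^ m, x ∈ (Ideal.jacobson (⊥ : Ideal Λ)) ^ m := by
    intro m hm
    induction m with
    | zero => exact absurd rfl hm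
    | succ m ih =>
      rcases Nat.eq_zero_or_pos m with rfl | h
      · intro x hx; simpa [radK_eq, Submodule.pow_one] using hx
      · intro x hx
        rw [pow_succ] at hx
        refine Submodule.mul_induction_on hx (fun a ha b hb => ?_) (fun _ _ => add_mem)
        rw [Submodule.pow_succ]
        refine Ideal.mul_mem_mul (ih h.ne' a ha) ?_
        simpa [radK_eq] using hb
  refine ⟨n + 1, eq_bot_iff.2 fun x hx => ?_⟩
  have := this _ n.succ_ne_zero x hx
  rw [Submodule.pow_succ, hn] at this
  simpa using this

theorem isNilpotent_of_mem_radK {x : Λ} (hx : x ∈ radK K Λ) : IsNilpotent x := by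
  obtain ⟨n, hn⟩ := radK_pow_eq_bot K Λ
  refine ⟨n, ?_⟩
  have : x ^ n ∈ radK K Λ ^ n := Submodule.pow_mem_pow _ hx n
  rwa [hn] at this

/-- If `y = y e` avoids a maximal left ideal, then `e` is in `Λ y`. -/
theorem IsPrimIdem.exists_mul_eq_of_notMem (K : Type) [Field K] {Λ : Type} [Ring Λ]
    [Algebra K Λ] [FiniteDimensional K Λ] {I : Ideal Λ} (hI : I.IsMaximal) {e y : Λ}
    (he : IsPrimIdem Λ e) (hy : y * e = y) (hyI : y ∉ I) :
    ∃ v : Λ, e * v = v ∧ v * y = e := by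
  obtain ⟨z, hz, heI⟩ := exists_corner_fix hI hy hyI
  have hw1 : e * (e * z * y) = e * z * y := by rw [← mul_assoc, ← mul_assoc, he.1.eq]
  have hw2 : e * z * y * e = e * z * y := by rw [mul_assoc, hy]
  have hfix : e * z * y - e ∈ I := by
    have := I.mul_mem_left e hz
    rwa [← mul_assoc, mul_sub, sub_mul, mul_one, he.1.eq, ← mul_assoc, hw2] at this
  rcases he.isNilpotent_or_exists_mul_eq K hw1 hw2 with ⟨n, hn⟩ | ⟨v, hv1, -, hv⟩
  · exfalso
    have : ∀ m : ℕ, (e * z * y) ^ m * e - e ∈ I := by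
      intro m
      induction m with
      | zero => simp
      | succ m ih =>
        have h3 : (e * z * y) ^ (m + 1) * e - e =
            (e * z * y) ^ m * (e * z * y - e) + ((e * z * y) ^ m * e - e) := by
          rw [pow_succ, mul_sub, mul_assoc, hw2]; abel
        rw [h3]; exact add_mem (I.mul_mem_left _ hfix) ih
    have h4 := this n
    rw [hn, zero_mul, zero_sub] at h4
    exact heI (by simpa using h4)
  · exact ⟨v * (e * z), by rw [← mul_assoc, hv1], by rw [mul_assoc, hv]⟩

theorem IsPrimIdem.mem_radK_of_isNilpotent {e n : Λ} (he : IsPrimIdem Λ e) (h1 : e * n = n)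
    (h2 : n * e = n) (hn : IsNilpotent n) : n ∈ radK K Λ := by
  rw [radK_mem_iff]
  intro I hI
  by_contra hnI
  obtain ⟨v, hv1, hv⟩ := he.exists_mul_eq_of_notMem K hI h2 hnI
  obtain ⟨r, hr⟩ := hn
  have : ∀ m : ℕ, ∃ u, u * n ^ m = e := by
    intro m
    induction m with
    | zero => exact ⟨e, by simp⟩
    | succ m ih =>
      obtain ⟨u, hu⟩ := ih
      refine ⟨v * u, ?_⟩
      rw [pow_succ, ← mul_assoc, mul_assoc v, hu, mul_assoc, h1, hv]
  obtain ⟨u, hu⟩ := this r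
  rw [hr, mul_zero] at hu
  exact he.2.1 hu.symm

theorem IsPrimIdem.exists_sub_mem_radK [IsAlgClosed K] {e : Λ} (he : IsPrimIdem Λ e) (x : Λ) :
    ∃ c : K, e * x * e - c • e ∈ radK K Λ := by
  have h1 : e * (e * x * e) = e * x * e := by rw [← mul_assoc, ← mul_assoc, he.1.eq]
  have h2 : e * x * e * e = e * x * e := by rw [mul_assoc, he.1.eq]
  obtain ⟨c, hc⟩ := he.exists_isNilpotent_sub (K := K) h1 h2
  exact ⟨c, he.mem_radK_of_isNilpotent (by rw [mul_sub, h1, mul_smul_comm, he.1.eq])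
    (by rw [sub_mul, h2, smul_mul_assoc, he.1.eq]) hc⟩

theorem mul_mem_radK_of_not_iso {e e' : Λ} (he : IsPrimIdem Λ e) (he' : IsPrimIdem Λ e')
    (hne : IsEmpty (↥(projMod Λ e) ≃ₗ[Λᵐᵒᵖ] ↥(projMod Λ e'))) (x : Λ) :
    e * x * e' ∈ radK K Λ := by
  rw [radK_mem_iff]
  intro I hI
  by_contra hnI
  have h1 : e * (e * x * e') = e * x * e' := by rw [← mul_assoc, ← mul_assoc, he.1.eq]
  have h2 : e * x * e' * e' = e * x * e' := by rw [mul_assoc, he'.1.eq]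
  obtain ⟨v, hv1, hv⟩ := he'.exists_mul_eq_of_notMem K hI h2 hnI
  set y := e * x * e'
  have hve : (v * e) * y = e' := by rw [mul_assoc, h1, hv]
  have hidem : IsIdempotentElem (y * (v * e)) := by
    rw [IsIdempotentElem, mul_assoc y, ← mul_assoc (v * e), hve, ← mul_assoc e', hv1]
  have hf1 : e * (y * (v * e)) = y * (v * e) := by rw [← mul_assoc, h1]
  have hf2 : (y * (v * e)) * e = y * (v * e) := by
    rw [mul_assoc, mul_assoc v, he.1.eq]
  rcases he.2.2 _ (e - y * (v * e)) hidem
    (by rw [IsIdempotentElem, mul_sub, sub_mul, sub_mul, he.1.eq, hf1, hf2, hidem.eq]; abel)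
    (by rw [mul_sub, hf2, hidem.eq, sub_self])
    (by rw [sub_mul, hf1, hidem.eq, sub_self]) (by abel) with h | h
  · apply he'.2.1
    have : (v * e) * (y * (v * e)) * y = e' := by
      rw [← mul_assoc (v * e) y, hve, mul_assoc, hve, he'.1.eq]
    rw [← this, h, mul_zero, zero_mul]
  · refine hne.elim (projMod_equiv (u := y) (v := v * e) ?_ h2 (sub_eq_zero.1 h).symm hve).some
    rw [mul_assoc, he.1.eq]

end Ring

/-- Coordinates of a bound quiver algebra modulo the square of its radical: the characters `χ k`
attached to the vertices and the twisted derivations `ψ i j a` attached to the arrows. -/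
structure Coords (K : Type) [Field K] (Λ : Type) [Ring Λ] [Algebra K Λ] {ι : Type} [Fintype ι]
    [DecidableEq ι] (e : ι → Λ) (Arr : ι → ι → Type) [∀ i j, Fintype (Arr i j)]
    (arr : ∀ i j, Arr i j → Λ) where
  χ : ι → Λ →ₗ[K] K
  ψ : ∀ i j, Arr i j → Λ →ₗ[K] K
  sub_mem : ∀ x, x - (∑ k, χ k x • e k + ∑ i, ∑ j, ∑ a, ψ i j a x • arr i j a) ∈
    radK K Λ * radK K Λ
  χ_idem : ∀ k l, χ k (e l) = if k = l then 1 else 0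
  χ_arr : ∀ k i j a, χ k (arr i j a) = 0
  χ_one : ∀ k, χ k 1 = 1
  χ_mul : ∀ k x y, χ k (x * y) = χ k x * χ k y
  ψ_one : ∀ i j a, ψ i j a 1 = 0
  ψ_idem : ∀ i j a k, ψ i j a (e k) = 0
  ψ_arr_self : ∀ i j a, ψ i j a (arr i j a) = 1
  ψ_arr_ne : ∀ i j a b, a ≠ b → ψ i j a (arr i j b) = 0
  ψ_mul : ∀ i j a x y, ψ i j a (x * y) = χ i x * ψ i j a y + ψ i j a x * χ j y

section Coords

variable {K : Type} [Field K] {Λ : Type} [Ring Λ] [Algebra K Λ]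
  {ι : Type} [Fintype ι] [DecidableEq ι] {e : ι → Λ}
  {Arr : ι → ι → Type} [∀ i j, Fintype (Arr i j)] {arr : ∀ i j, Arr i j → Λ}

/-- Idempotents and arrows, as one family. -/
def quiverFamily (e : ι → Λ) (arr : ∀ i j, Arr i j → Λ) :
    ι ⊕ (Σ i : ι, Σ j : ι, Arr i j) → Λ :=
  Sum.elim e fun p => arr p.1 p.2.1 p.2.2

theorem radK_le_span_quiverFamily (h : IsGabrielPres Λ K e Arr arr) :
    radK K Λ ≤ Submodule.span K (Set.range (quiverFamily e arr)) ⊔ radK K Λ * radK K Λ := by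
  refine h.2.2.2.1.trans (sup_le_sup_right (Submodule.span_mono ?_) _)
  rintro _ ⟨p, rfl⟩
  exact ⟨Sum.inr p, rfl⟩

theorem span_quiverFamily [IsAlgClosed K] [FiniteDimensional K Λ]
    (h : IsGabrielPres Λ K e Arr arr) :
    Submodule.span K (Set.range (quiverFamily e arr)) ⊔ radK K Λ * radK K Λ = ⊤ := by
  have hR := radK_le_span_quiverFamily h
  have he : ∀ k, e k ∈ Submodule.span K (Set.range (quiverFamily e arr)) ⊔
      radK K Λ * radK K Λ := fun k =>
    Submodule.mem_sup_left (Submodule.subset_span ⟨Sum.inl k, rfl⟩)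
  rw [eq_top_iff]
  intro x _
  have hx : x = ∑ k, ∑ l, e k * x * e l := by
    rw [← Finset.sum_mul_sum, ← Finset.sum_mul, h.1.2.2, one_mul, mul_one]
  rw [hx]
  refine Submodule.sum_mem _ fun k _ => Submodule.sum_mem _ fun l _ => ?_
  by_cases hkl : k = l
  · subst hkl
    obtain ⟨c, hc⟩ := (h.1.1 k).exists_sub_mem_radK (K := K) x
    have := add_mem (hR hc) (Submodule.smul_mem _ c (he k))
    rwa [sub_add_cancel] at this
  · exact hR (mul_mem_radK_of_not_iso (h.1.1 k) (h.1.1 l) (h.2.1 k l hkl) x)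

theorem linearMap_ext_of_pres [IsAlgClosed K] [FiniteDimensional K Λ]
    (h : IsGabrielPres Λ K e Arr arr) {V : Type} [AddCommGroup V]
    [Module K V] {f g : Λ →ₗ[K] V} (he : ∀ k, f (e k) = g (e k))
    (ha : ∀ i j a, f (arr i j a) = g (arr i j a))
    (hR : ∀ x ∈ radK K Λ * radK K Λ, f x = g x) : f = g := by
  have : (⊤ : Submodule K Λ) ≤ LinearMap.eqLocus f g := by
    rw [← span_quiverFamily h]
    refine sup_le (Submodule.span_le.2 ?_) hR
    rintro _ ⟨k | p, rfl⟩
    · exact he k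
    · exact ha _ _ _
  exact LinearMap.ext fun x => this trivial

theorem IsGabrielPres.idem_notMem_radK [FiniteDimensional K Λ] (h : IsGabrielPres Λ K e Arr arr) (k : ι) :
    e k ∉ radK K Λ := by
  intro hk
  obtain ⟨n, hn⟩ := isNilpotent_of_mem_radK hk
  have := (h.1.1 k).1.pow_succ_eq n
  rw [pow_succ, hn, zero_mul] at this
  exact (h.1.1 k).2.1 this.symm

theorem IsGabrielPres.idem_mul (h : IsGabrielPres Λ K e Arr arr) (k l : ι) :
    e k * e l = if k = l then e l else 0 := by
  split_ifs with hkl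
  · rw [hkl]; exact (h.1.1 l).1
  · exact h.1.2.1 hkl

theorem IsGabrielPres.idem_mul_arr (h : IsGabrielPres Λ K e Arr arr) (k i j : ι) (a : Arr i j) :
    e k * arr i j a = if k = i then arr i j a else 0 := by
  conv_lhs => rw [← (h.2.2.1 i j a).2, ← mul_assoc, ← mul_assoc, h.idem_mul]
  split_ifs
  · exact (h.2.2.1 i j a).2
  · simp

theorem IsGabrielPres.arr_mul_idem (h : IsGabrielPres Λ K e Arr arr) (i j k : ι) (a : Arr i j) :
    arr i j a * e k = if j = k then arr i j a else 0 := by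
  conv_lhs => rw [← (h.2.2.1 i j a).2, mul_assoc, h.idem_mul]
  split_ifs with hk
  · rw [← hk]; exact (h.2.2.1 i j a).2
  · simp

theorem linearIndependent_quiverFamily [FiniteDimensional K Λ] (h : IsGabrielPres Λ K e Arr arr) :
    LinearIndependent K ((radK K Λ * radK K Λ).mkQ ∘ quiverFamily e arr) := by
  rw [Fintype.linearIndependent_iff]
  intro g hg
  have h1 : ∑ k, g (Sum.inl k) • e k +
      ∑ p : Σ i : ι, Σ j : ι, Arr i j, g (Sum.inr p) • arr p.1 p.2.1 p.2.2 ∈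
        radK K Λ * radK K Λ := by
    rw [← Submodule.Quotient.mk_eq_zero, ← hg, Fintype.sum_sum_type, ← Submodule.mkQ_apply,
      map_add, map_sum, map_sum]
    rfl
  have hA : ∑ p : Σ i : ι, Σ j : ι, Arr i j, g (Sum.inr p) • arr p.1 p.2.1 p.2.2 ∈ radK K Λ :=
    Submodule.sum_mem _ fun p _ => Submodule.smul_mem _ _ (h.2.2.1 _ _ _).1
  have h2 : ∑ k, g (Sum.inl k) • e k ∈ radK K Λ := by
    have := sub_mem (radSq_le K Λ h1) hA
    rwa [add_sub_cancel_right] at this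
  have h3 : ∀ l, g (Sum.inl l) = 0 := by
    intro l
    by_contra hl
    have := radK_mul_mem_left (e l) h2
    simp only [Finset.mul_sum, mul_smul_comm, h.idem_mul] at this
    rw [Finset.sum_eq_single l (fun b _ hb => by simp [Ne.symm hb]) (by simp)] at this
    simp only [if_true] at this
    have h4 := Submodule.smul_mem _ (g (Sum.inl l))⁻¹ this
    rw [smul_smul, inv_mul_cancel₀ hl, one_smul] at h4
    exact h.idem_notMem_radK l h4
  have h4 := h.2.2.2.2 (fun p => g (Sum.inr p)) (by simpa [h3] using h1)
  rintro (k | p)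
  · exact h3 k
  · exact h4 p

theorem exists_quiverFamily_coord [IsAlgClosed K] [FiniteDimensional K Λ]
    (h : IsGabrielPres Λ K e Arr arr)
    [DecidableEq (ι ⊕ (Σ i : ι, Σ j : ι, Arr i j))] :
    ∃ c : ι ⊕ (Σ i : ι, Σ j : ι, Arr i j) → Λ →ₗ[K] K,
      (∀ s t, c s (quiverFamily e arr t) = if s = t then 1 else 0) ∧
      (∀ s, ∀ x ∈ radK K Λ * radK K Λ, c s x = 0) ∧
      ∀ x, x - ∑ s, c s x • quiverFamily e arr s ∈ radK K Λ * radK K Λ := by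
  have hspan : ⊤ ≤ Submodule.span K
      (Set.range ((radK K Λ * radK K Λ).mkQ ∘ quiverFamily e arr)) := by
    have := congrArg (Submodule.map (radK K Λ * radK K Λ).mkQ) (span_quiverFamily h)
    rw [Submodule.map_sup, Submodule.mkQ_map_self, sup_bot_eq, Submodule.map_top,
      Submodule.range_mkQ] at this
    rw [Set.range_comp, Submodule.span_image, this]
  let B := Module.Basis.mk (linearIndependent_quiverFamily h) hspan
  have hB : ∀ t, B t = (radK K Λ * radK K Λ).mkQ (quiverFamily e arr t) := by
    intro t
    rw [Module.Basis.mk_apply]; rfl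
  refine ⟨fun s => B.coord s ∘ₗ (radK K Λ * radK K Λ).mkQ, fun s t => ?_, fun s x hx => ?_,
    fun x => ?_⟩
  · simp only [LinearMap.comp_apply, ← hB, Module.Basis.coord_apply, Module.Basis.repr_self,
      Finsupp.single_apply, eq_comm]
  · simp only [LinearMap.comp_apply, Submodule.mkQ_apply,
      (Submodule.Quotient.mk_eq_zero _).2 hx, map_zero]
  · rw [← Submodule.Quotient.mk_eq_zero, ← Submodule.mkQ_apply, map_sub, sub_eq_zero]
    conv_lhs => rw [← B.sum_repr ((radK K Λ * radK K Λ).mkQ x)]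
    simp only [map_sum, map_smul, hB]
    rfl

theorem bilin_ext_of_pres [IsAlgClosed K] [FiniteDimensional K Λ]
    (h : IsGabrielPres Λ K e Arr arr) {f g : Λ →ₗ[K] Λ →ₗ[K] K}
    (hs : ∀ s t, f (quiverFamily e arr s) (quiverFamily e arr t) =
      g (quiverFamily e arr s) (quiverFamily e arr t))
    (hl : ∀ x ∈ radK K Λ * radK K Λ, ∀ y, f x y = g x y)
    (hr : ∀ x, ∀ y ∈ radK K Λ * radK K Λ, f x y = g x y) : f = g := by
  have key : ∀ s, f (quiverFamily e arr s) = g (quiverFamily e arr s) := fun s =>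
    linearMap_ext_of_pres h (fun k => hs s (Sum.inl k))
      (fun i j a => hs s (Sum.inr ⟨i, j, a⟩)) (hr _)
  exact linearMap_ext_of_pres h (fun k => key (Sum.inl k))
    (fun i j a => key (Sum.inr ⟨i, j, a⟩)) fun x hx => LinearMap.ext (hl x hx)

theorem nonempty_coords [IsAlgClosed K] [FiniteDimensional K Λ]
    (h : IsGabrielPres Λ K e Arr arr) : Nonempty (Coords K Λ e Arr arr) := by
  classical
  obtain ⟨c, hcb, hcR, hcs⟩ := exists_quiverFamily_coord h
  have hee : ∀ k l, c (Sum.inl k) (e l) = if k = l then 1 else 0 := by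
    intro k l; simpa [quiverFamily] using hcb (Sum.inl k) (Sum.inl l)
  have hea : ∀ k i j a, c (Sum.inl k) (arr i j a) = 0 := by
    intro k i j a; simpa [quiverFamily] using hcb (Sum.inl k) (Sum.inr ⟨i, j, a⟩)
  have hae : ∀ p k, c (Sum.inr p) (e k) = 0 := by
    intro p k; simpa [quiverFamily] using hcb (Sum.inr p) (Sum.inl k)
  have haa : ∀ p i j a, c (Sum.inr p) (arr i j a) = if p = ⟨i, j, a⟩ then 1 else 0 := by
    intro p i j a; simpa [quiverFamily] using hcb (Sum.inr p) (Sum.inr ⟨i, j, a⟩)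
  have hrad : ∀ k, ∀ x ∈ radK K Λ, c (Sum.inl k) x = 0 := by
    intro k
    suffices radK K Λ ≤ LinearMap.ker (c (Sum.inl k)) from fun x hx => this hx
    refine h.2.2.2.1.trans (sup_le (Submodule.span_le.2 ?_) (hcR _))
    rintro _ ⟨p, rfl⟩
    exact hea _ _ _ _
  have hmul : ∀ k x y, c (Sum.inl k) (x * y) = c (Sum.inl k) x * c (Sum.inl k) y := by
    intro k x y
    have : (LinearMap.mul K Λ).compr₂ (c (Sum.inl k)) =
        (LinearMap.mul K K).compl₁₂ (c (Sum.inl k)) (c (Sum.inl k)) := by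
      refine bilin_ext_of_pres h ?_ (fun x hx y => ?_) (fun x y hy => ?_)
      · rintro (l | p) (m | q)
        · change c (Sum.inl k) (e l * e m) = c (Sum.inl k) (e l) * c (Sum.inl k) (e m)
          rw [h.idem_mul, hee, hee]
          by_cases h1 : l = m
          · subst h1
            rw [if_pos rfl, hee]
            split_ifs
            · rw [mul_one]
            · rw [mul_zero]
          · rw [if_neg h1, map_zero]
            by_cases h2 : k = l
            · rw [if_neg fun hk => h1 (h2.symm.trans hk), mul_zero]
            · rw [if_neg h2, zero_mul]
        · change c (Sum.inl k) (e l * arr _ _ q.2.2) = c (Sum.inl k) (e l) * c (Sum.inl k) (arr _ _ q.2.2)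
          rw [hea, hrad k _ (radK_mul_mem_left _ (h.2.2.1 _ _ _).1), mul_zero]
        · change c (Sum.inl k) (arr _ _ p.2.2 * e m) = c (Sum.inl k) (arr _ _ p.2.2) * c (Sum.inl k) (e m)
          rw [hea, hrad k _ (radK_mul_mem_right _ (h.2.2.1 _ _ _).1), zero_mul]
        · change c (Sum.inl k) (arr _ _ p.2.2 * arr _ _ q.2.2) =
            c (Sum.inl k) (arr _ _ p.2.2) * c (Sum.inl k) (arr _ _ q.2.2)
          rw [hea, hrad k _ (radK_mul_mem_right _ (h.2.2.1 _ _ _).1), zero_mul]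
      · change c (Sum.inl k) (x * y) = c (Sum.inl k) x * c (Sum.inl k) y
        rw [hcR _ _ (radSq_mul_mem_right y hx), hcR _ x hx, zero_mul]
      · change c (Sum.inl k) (x * y) = c (Sum.inl k) x * c (Sum.inl k) y
        rw [hcR _ _ (radSq_mul_mem_left x hy), hcR _ y hy, mul_zero]
    exact LinearMap.congr_fun₂ this x y
  have hder : ∀ i j a x y, c (Sum.inr ⟨i, j, a⟩) (x * y) =
      c (Sum.inl i) x * c (Sum.inr ⟨i, j, a⟩) y + c (Sum.inr ⟨i, j, a⟩) x * c (Sum.inl j) y := by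
    intro i j a x y
    have : (LinearMap.mul K Λ).compr₂ (c (Sum.inr ⟨i, j, a⟩)) =
        (LinearMap.mul K K).compl₁₂ (c (Sum.inl i)) (c (Sum.inr ⟨i, j, a⟩)) +
          (LinearMap.mul K K).compl₁₂ (c (Sum.inr ⟨i, j, a⟩)) (c (Sum.inl j)) := by
      have red : ∀ x y, ((LinearMap.mul K Λ).compr₂ (c (Sum.inr ⟨i, j, a⟩)) x y =
        ((LinearMap.mul K K).compl₁₂ (c (Sum.inl i)) (c (Sum.inr ⟨i, j, a⟩)) +
          (LinearMap.mul K K).compl₁₂ (c (Sum.inr ⟨i, j, a⟩)) (c (Sum.inl j))) x y) =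
        (c (Sum.inr ⟨i, j, a⟩) (x * y) = c (Sum.inl i) x * c (Sum.inr ⟨i, j, a⟩) y +
          c (Sum.inr ⟨i, j, a⟩) x * c (Sum.inl j) y) := fun _ _ => rfl
      refine bilin_ext_of_pres h ?_ (fun x hx y => ?_) (fun x y hy => ?_)
      · rintro (k | ⟨k, l, b⟩) (m | ⟨k', l', b'⟩) <;> rw [red] <;>
          simp only [quiverFamily, Sum.elim_inl, Sum.elim_inr]
        · rw [h.idem_mul]; split_ifs <;> simp [hae]
        · rw [h.idem_mul_arr, hee, hae, zero_mul, add_zero, haa]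
          by_cases h1 : (⟨i, j, a⟩ : Σ i : ι, Σ j : ι, Arr i j) = ⟨k', l', b'⟩
          · obtain rfl : i = k' := congrArg Sigma.fst h1
            by_cases h2 : i = k
            · subst h2; simp [haa, h1]
            · simp [h2, Ne.symm h2]
          · rw [if_neg h1, mul_zero]
            split_ifs
            · rw [haa, if_neg h1]
            · simp
        · rw [h.arr_mul_idem, hae, mul_zero, zero_add, hee, haa]
          by_cases h1 : (⟨i, j, a⟩ : Σ i : ι, Σ j : ι, Arr i j) = ⟨k, l, b⟩
          · obtain rfl : i = k := congrArg Sigma.fst h1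
            obtain rfl : j = l := congrArg (fun p => p.2.1) h1
            by_cases h2 : j = m
            · subst h2; simp [haa, h1]
            · simp [h2]
          · rw [if_neg h1, zero_mul]
            split_ifs
            · rw [haa, if_neg h1]
            · simp
        · rw [hea, hea, zero_mul, mul_zero, add_zero]
          exact hcR _ _ (Submodule.mul_mem_mul (h.2.2.1 _ _ _).1 (h.2.2.1 _ _ _).1)
      · rw [red, hcR _ _ (radSq_mul_mem_right y hx), hcR (Sum.inl i) x hx,
          hcR (Sum.inr _) x hx, zero_mul, zero_mul, add_zero]
      · rw [red, hcR _ _ (radSq_mul_mem_left x hy), hcR _ y hy, hrad _ y (radSq_le K Λ hy),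
          mul_zero, mul_zero, add_zero]
    exact LinearMap.congr_fun₂ this x y
  refine ⟨{ χ := fun k => c (Sum.inl k)
            ψ := fun i j a => c (Sum.inr ⟨i, j, a⟩)
            sub_mem := ?_
            χ_idem := hee
            χ_arr := hea
            χ_one := ?_
            χ_mul := hmul
            ψ_one := ?_
            ψ_idem := fun i j a k => hae _ _
            ψ_arr_self := fun i j a => by simp [haa]
            ψ_arr_ne := fun i j a b hab => by simp [haa, hab]
            ψ_mul := hder }⟩
  · intro x
    have := hcs x
    rw [Fintype.sum_sum_type, Fintype.sum_sigma] at this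
    simp only [Fintype.sum_sigma] at this
    exact this
  · intro k
    simp [← h.1.2.2, hee]
  · intro i j a
    simp [← h.1.2.2, hae]

end Coords

/-- A bound quiver presentation without loops and `2`-cycles, together with coordinates modulo the
square of the radical. -/
structure QData (K : Type) [Field K] (Λ : Type) [Ring Λ] [Algebra K Λ] {ι : Type} [Fintype ι]
    [DecidableEq ι] (e : ι → Λ) (Arr : ι → ι → Type) [∀ i j, Fintype (Arr i j)]
    (arr : ∀ i j, Arr i j → Λ) extends Coords K Λ e Arr arr where
  pres : IsGabrielPres Λ K e Arr arr
  not_loop : ∀ i, Arr i i → False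
  not_cycle : ∀ i j, Arr i j → Arr j i → False

section QData

variable {K : Type} [Field K] {Λ : Type} [Ring Λ] [Algebra K Λ]
  {ι : Type} [Fintype ι] [DecidableEq ι] {e : ι → Λ}
  {Arr : ι → ι → Type} [∀ i j, Fintype (Arr i j)] {arr : ∀ i j, Arr i j → Λ}

theorem nonempty_qData [IsAlgClosed K] [FiniteDimensional K Λ]
    (h : IsGabrielPres Λ K e Arr arr) (hac : ∀ i (p : QPath Arr i i), p = QPath.nil i) :
    Nonempty (QData K Λ e Arr arr) := by
  obtain ⟨C⟩ := nonempty_coords h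
  exact ⟨{ C with
    pres := h
    not_loop := fun i a => by cases hac i (.cons a (.nil i))
    not_cycle := fun i j a b => by cases hac i (.cons a (.cons b (.nil i))) }⟩

/-- The support of the right module `M` is contained in `{i, j}`. -/
def SuppIn (e : ι → Λ) (i j : ι) (M : Type) [AddCommGroup M] [Module Λᵐᵒᵖ M] : Prop :=
  ∀ k, k ≠ i → k ≠ j → ∀ m : M, op (e k) • m = 0

theorem SuppIn.symm {i j : ι} {M : Type} [AddCommGroup M] [Module Λᵐᵒᵖ M]
    (h : SuppIn e i j M) : SuppIn e j i M := fun k hi hj => h k hj hi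

/-- The square of the radical annihilates the right module `M`. -/
def LL2 (K : Type) [Field K] {Λ : Type} [Ring Λ] [Algebra K Λ] (M : Type) [AddCommGroup M]
    [Module Λᵐᵒᵖ M] : Prop :=
  ∀ x ∈ radK K Λ * radK K Λ, ∀ m : M, op x • m = 0

section Modules

variable {M : Type} [AddCommGroup M] [Module Λᵐᵒᵖ M] [Module K M] [IsScalarTower K Λᵐᵒᵖ M]
variable {N : Type} [AddCommGroup N] [Module Λᵐᵒᵖ N] [Module K N] [IsScalarTower K Λᵐᵒᵖ N]

/-- The orbit map `x ↦ m x` of an element of a right module. -/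
def orbitMap (K : Type) [Field K] {Λ : Type} [Ring Λ] [Algebra K Λ] {M : Type} [AddCommGroup M]
    [Module Λᵐᵒᵖ M] [Module K M] [IsScalarTower K Λᵐᵒᵖ M] (m : M) : Λ →ₗ[K] M where
  toFun x := op x • m
  map_add' x y := by rw [op_add, add_smul]
  map_smul' c x := by rw [op_smul, smul_assoc]; rfl

theorem orbitMap_apply (m : M) (x : Λ) : orbitMap K m x = op x • m := rfl

theorem ll2_of_suppIn [FiniteDimensional K Λ] (C : QData K Λ e Arr arr) {i j : ι}
    (hM : SuppIn e i j M) : LL2 K (Λ := Λ) M := by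
  let ann : Submodule K Λ := ⨅ m : M, LinearMap.ker (orbitMap K m)
  have hann : ∀ x, x ∈ ann ↔ ∀ m : M, op x • m = 0 := by
    intro x; simp [ann, Submodule.mem_iInf, orbitMap_apply]
  have hbc : ∀ k l (b : Arr k l) l' m (c : Arr l' m), arr k l b * arr l' m c ∈ ann := by
    intro k l b l' m c
    rw [hann]
    intro x
    by_cases hl : l = l'
    · subst hl
      have hmem : ∀ v, v ≠ i → v ≠ j → op (e v) • x = 0 := fun v h1 h2 => hM v h1 h2 x
      have hb : op (arr k l b) • x = op (arr k l b) • op (e k) • x := by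
        rw [← mul_smul, ← op_mul, C.pres.idem_mul_arr, if_pos rfl]
      have hb' : op (arr k l b) • x = op (e l) • op (arr k l b) • x := by
        rw [← mul_smul, ← op_mul, C.pres.arr_mul_idem, if_pos rfl]
      have hc' : op (arr l m c) • op (arr k l b) • x =
          op (e m) • op (arr l m c) • op (arr k l b) • x := by
        rw [← mul_smul (op (e m)), ← op_mul, C.pres.arr_mul_idem, if_pos rfl]
      rw [op_mul, mul_smul]
      by_cases hk : k = i ∨ k = j
      · by_cases hl : l = i ∨ l = j
        · by_cases hm : m = i ∨ m = j
          · exfalso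
            have hkl : k ≠ l := fun h => by subst h; exact C.not_loop _ b
            have hlm : l ≠ m := fun h => by subst h; exact C.not_loop _ c
            have : m = k := by
              rcases hk with rfl | rfl <;> rcases hl with rfl | rfl <;>
                rcases hm with rfl | rfl <;> first | rfl | exact absurd rfl hkl | exact absurd rfl hlm
            subst this
            exact C.not_cycle _ _ b c
          · push Not at hm
            rw [hc', hM m hm.1 hm.2]
        · push Not at hl
          rw [hb', hM l hl.1 hl.2, smul_zero]
      · push Not at hk
        rw [hb, hM k hk.1 hk.2, smul_zero, smul_zero]
    · have : arr k l b * arr l' m c = 0 := by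
        rw [← (C.pres.2.2.1 l' m c).2, mul_assoc (e l'), ← mul_assoc, C.pres.arr_mul_idem,
          if_neg hl, zero_mul]
      rw [this, op_zero, zero_smul]
  set R := radK K Λ with hR
  set V := Submodule.span K
    (Set.range fun p : Σ i : ι, Σ j : ι, Arr i j => arr p.1 p.2.1 p.2.2) with hV
  have hRV : R ≤ V ⊔ R * R := C.pres.2.2.2.1
  have hVR : V ≤ R := Submodule.span_le.2 (by rintro _ ⟨p, rfl⟩; exact (C.pres.2.2.1 _ _ _).1)
  have hVV : V * V ≤ ann := by
    rw [hV, Submodule.span_mul_span, Submodule.span_le]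
    rintro _ ⟨_, ⟨p, rfl⟩, _, ⟨q, rfl⟩, rfl⟩
    exact hbc _ _ _ _ _ _
  have h2 : R * R ≤ ann ⊔ R * R * R := by
    calc R * R ≤ (V ⊔ R * R) * R := mul_le_mul' hRV le_rfl
      _ = V * R ⊔ R * R * R := Submodule.sup_mul _ _ _
      _ ≤ V * (V ⊔ R * R) ⊔ R * R * R :=
        sup_le_sup_right (mul_le_mul' le_rfl hRV) _
      _ = V * V ⊔ V * (R * R) ⊔ R * R * R := by rw [Submodule.mul_sup]
      _ ≤ ann ⊔ R * R * R := by
        refine sup_le (sup_le_sup hVV ?_) le_sup_right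
        rw [← mul_assoc]
        exact mul_le_mul' (mul_le_mul' hVR le_rfl) le_rfl
  have hannR : ann * R ≤ ann := by
    rw [Submodule.mul_le]
    intro x hx y _
    rw [hann] at hx ⊢
    intro m
    rw [op_mul, mul_smul, hx, smul_zero]
  have hn : ∀ n, R * R ≤ ann ⊔ R * R * R ^ n := by
    intro n
    induction n with
    | zero => simp
    | succ n ih =>
      calc R * R ≤ ann ⊔ R * R * R := h2
        _ ≤ ann ⊔ (ann ⊔ R * R * R ^ n) * R :=
          sup_le_sup_left (mul_le_mul' ih le_rfl) _
        _ = ann ⊔ (ann * R ⊔ R * R * R ^ n * R) := by rw [Submodule.sup_mul]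
        _ ≤ ann ⊔ R * R * R ^ (n + 1) := by
          rw [mul_assoc _ _ R, ← pow_succ]
          exact sup_le le_sup_left (sup_le_sup_right hannR _)
  obtain ⟨n, hn0⟩ := radK_pow_eq_bot K Λ
  have := hn n
  rw [hn0, Submodule.mul_bot, sup_bot_eq] at this
  exact fun x hx => (hann x).1 (this hx)

theorem smul_eq_sum (C : QData K Λ e Arr arr) (hM : LL2 K (Λ := Λ) M) (x : Λ) (m : M) :
    op x • m = ∑ k, C.χ k x • op (e k) • m +
      ∑ i, ∑ j, ∑ a, C.ψ i j a x • op (arr i j a) • m := by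
  have := hM _ (C.sub_mem x) m
  rw [← orbitMap_apply (K := K), map_sub, sub_eq_zero] at this
  rw [← orbitMap_apply (K := K), this]
  simp only [map_add, map_sum, map_smul, orbitMap_apply]

/-- A `K`-linear map between modules of Loewy length two commuting with the vertex idempotents and
with the arrows is a module homomorphism. -/
def liftHom (C : QData K Λ e Arr arr) (hM : LL2 K (Λ := Λ) M) (hN : LL2 K (Λ := Λ) N)
    (f : M →ₗ[K] N) (he : ∀ k m, f (op (e k) • m) = op (e k) • f m)
    (ha : ∀ i j a m, f (op (arr i j a) • m) = op (arr i j a) • f m) : M →ₗ[Λᵐᵒᵖ] N where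
  toFun := f
  map_add' := f.map_add
  map_smul' x m := by
    induction x using MulOpposite.rec' with
    | h x =>
      rw [smul_eq_sum C hM, RingHom.id_apply, smul_eq_sum C hN]
      simp only [map_add, map_sum, map_smul, he, ha]

theorem liftHom_apply (C : QData K Λ e Arr arr) (hM : LL2 K (Λ := Λ) M) (hN : LL2 K (Λ := Λ) N)
    (f : M →ₗ[K] N) (he) (ha) (m : M) : liftHom C hM hN f he ha m = f m := rfl

/-- A subspace of a module of Loewy length two stable under the vertex idempotents and the arrows
is a submodule. -/
def liftSub (C : QData K Λ e Arr arr) (hM : LL2 K (Λ := Λ) M) (p : Submodule K M)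
    (he : ∀ k, ∀ m ∈ p, op (e k) • m ∈ p) (ha : ∀ i j a, ∀ m ∈ p, op (arr i j a) • m ∈ p) :
    Submodule Λᵐᵒᵖ M where
  carrier := p
  add_mem' := p.add_mem
  zero_mem' := p.zero_mem
  smul_mem' x m hm := by
    induction x using MulOpposite.rec' with
    | h x =>
      rw [smul_eq_sum C hM]
      exact p.add_mem (p.sum_mem fun k _ => p.smul_mem _ (he k m hm))
        (p.sum_mem fun i _ => p.sum_mem fun j _ => p.sum_mem fun a _ =>
          p.smul_mem _ (ha i j a m hm))

end Modules

section Plain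

variable {M : Type} [AddCommGroup M] [Module Λᵐᵒᵖ M]
  {N : Type} [AddCommGroup N] [Module Λᵐᵒᵖ N]

theorem sum_idem_smul (C : QData K Λ e Arr arr) (m : M) : ∑ k, op (e k) • m = m := by
  rw [← Finset.sum_smul, ← Finset.op_sum, C.pres.1.2.2, op_one, one_smul]

theorem idem_smul_idem_smul (C : QData K Λ e Arr arr) (k l : ι) (m : M) :
    op (e k) • op (e l) • m = if k = l then op (e k) • m else 0 := by
  rw [← mul_smul, ← op_mul, C.pres.idem_mul]
  split_ifs with h1 h2 h2
  · rfl
  · exact absurd h1.symm h2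
  · exact absurd h2.symm h1
  · rw [op_zero, zero_smul]

theorem arr_smul_idem_smul (C : QData K Λ e Arr arr) {i j : ι} (a : Arr i j) (k : ι) (m : M) :
    op (arr i j a) • op (e k) • m = if k = i then op (arr i j a) • m else 0 := by
  rw [← mul_smul, ← op_mul, C.pres.idem_mul_arr]
  split_ifs
  · rfl
  · rw [op_zero, zero_smul]

theorem idem_smul_arr_smul (C : QData K Λ e Arr arr) {i j : ι} (a : Arr i j) (k : ι) (m : M) :
    op (e k) • op (arr i j a) • m = if k = j then op (arr i j a) • m else 0 := by
  rw [← mul_smul, ← op_mul, C.pres.arr_mul_idem]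
  split_ifs with h1 h2 h2
  · rfl
  · exact absurd h1.symm h2
  · exact absurd h2.symm h1
  · rw [op_zero, zero_smul]

theorem SuppIn.arr_smul_eq_zero (C : QData K Λ e Arr arr) {i j : ι} (hM : SuppIn e i j M)
    {k l : ι} (b : Arr k l) (h : ¬ (k = i ∧ l = j)) (h' : ¬ (k = j ∧ l = i)) (m : M) :
    op (arr k l b) • m = 0 := by
  have hkl : k ≠ l := fun h => by subst h; exact C.not_loop _ b
  by_cases hk : k ≠ i ∧ k ≠ j
  · have := arr_smul_idem_smul C b k m
    rw [if_pos rfl, hM k hk.1 hk.2, smul_zero] at this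
    exact this.symm
  · have := idem_smul_arr_smul C b l m
    rw [if_pos rfl, hM l] at this
    · exact this.symm
    · rintro rfl
      refine hk ⟨fun h => hkl h, fun h2 => h' ⟨h2, rfl⟩⟩
    · rintro rfl
      refine hk ⟨fun h1 => h ⟨h1, rfl⟩, fun h => hkl h⟩

theorem SuppIn.of_surjective {i j : ι} (hM : SuppIn e i j M) (f : M →ₗ[Λᵐᵒᵖ] N)
    (hf : Function.Surjective f) : SuppIn e i j N := by
  intro k hi hj n
  obtain ⟨m, rfl⟩ := hf n
  rw [← map_smul, hM k hi hj, map_zero]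

theorem SuppIn.prod {i j : ι} (hM : SuppIn e i j M) (hN : SuppIn e i j N) :
    SuppIn e i j (M × N) :=
  fun k hi hj m => Prod.ext (hM k hi hj m.1) (hN k hi hj m.2)

theorem SuppIn.pi {i j : ι} (hM : SuppIn e i j M) (n : ℕ) : SuppIn e i j (Fin n → M) :=
  fun k hi hj m => funext fun t => hM k hi hj (m t)

/-- A module with submodule and quotient supported in `{i, j}` is supported there. -/
theorem SuppIn.of_exact (C : QData K Λ e Arr arr) {i j : ι} {E : Type} [AddCommGroup E]
    [Module Λᵐᵒᵖ E] (hM : SuppIn e i j M) (hN : SuppIn e i j N) (f : N →ₗ[Λᵐᵒᵖ] E)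
    (g : E →ₗ[Λᵐᵒᵖ] M) (hfg : LinearMap.range f = LinearMap.ker g) : SuppIn e i j E := by
  intro k hi hj m
  have h1 : op (e k) • m ∈ LinearMap.ker g := by
    rw [LinearMap.mem_ker, map_smul, hM k hi hj]
  rw [← hfg] at h1
  obtain ⟨x, hx⟩ := h1
  have h2 := idem_smul_idem_smul C k k m
  rw [if_pos rfl, ← hx, ← map_smul, hN k hi hj, map_zero] at h2
  rw [← hx, ← h2]

end Plain

end QData

section Extensions

variable {K : Type} [Field K] {Λ : Type} [Ring Λ] [Algebra K Λ]
  {ι : Type} [Fintype ι] [DecidableEq ι] {e : ι → Λ}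
  {Arr : ι → ι → Type} [∀ i j, Fintype (Arr i j)] {arr : ∀ i j, Arr i j → Λ}
variable {M : Type} [AddCommGroup M] [Module Λᵐᵒᵖ M] [Module K M] [IsScalarTower K Λᵐᵒᵖ M]
variable {N : Type} [AddCommGroup N] [Module Λᵐᵒᵖ N] [Module K N] [IsScalarTower K Λᵐᵒᵖ N]
variable {X : Type} [AddCommGroup X] [Module Λᵐᵒᵖ X] [Module K X] [IsScalarTower K Λᵐᵒᵖ X]

/-- The action of an element of the algebra as a `K`-linear endomorphism. -/
def actMap (K : Type) [Field K] {Λ : Type} [Ring Λ] [Algebra K Λ] (M : Type) [AddCommGroup M]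
    [Module Λᵐᵒᵖ M] [Module K M] [IsScalarTower K Λᵐᵒᵖ M] (x : Λ) : M →ₗ[K] M where
  toFun m := op x • m
  map_add' := smul_add _
  map_smul' _ _ := smul_comm _ _ _

theorem actMap_apply (x : Λ) (m : M) : actMap K M x m = op x • m := rfl

/-- Every cocycle along the arrows `i → j` is a coboundary. -/
def ExtCrit (K : Type) [Field K] {Λ : Type} [Ring Λ] [Algebra K Λ] {ι : Type} (e : ι → Λ)
    {Arr : ι → ι → Type} (arr : ∀ i j, Arr i j → Λ) (i j : ι)
    (M : Type) [AddCommGroup M] [Module Λᵐᵒᵖ M] [Module K M]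
    (X : Type) [AddCommGroup X] [Module Λᵐᵒᵖ X] [Module K X] : Prop :=
  ∀ δ : Arr i j → M →ₗ[K] X, (∀ a m, δ a (op (e i) • m) = δ a m) →
    (∀ a m, op (e j) • δ a m = δ a m) →
    ∃ t : M →ₗ[K] X, (∀ k m, t (op (e k) • m) = op (e k) • t m) ∧
      ∀ a m, δ a m = op (arr i j a) • t m - t (op (arr i j a) • m)

/-- A module map as a `K`-linear map. -/
def toLin (K : Type) [Field K] {Λ : Type} [Ring Λ] [Algebra K Λ] {M N : Type} [AddCommGroup M]
    [Module Λᵐᵒᵖ M] [Module K M] [IsScalarTower K Λᵐᵒᵖ M] [AddCommGroup N]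
    [Module Λᵐᵒᵖ N] [Module K N] [IsScalarTower K Λᵐᵒᵖ N] (f : M →ₗ[Λᵐᵒᵖ] N) : M →ₗ[K] N where
  toFun := f
  map_add' := f.map_add
  map_smul' c m := by
    rw [RingHom.id_apply, ← one_smul Λᵐᵒᵖ m, ← smul_assoc, map_smul, map_smul, smul_assoc]

theorem toLin_apply (f : M →ₗ[Λᵐᵒᵖ] N) (m : M) : toLin K f m = f m := rfl

theorem ExtCrit.prod {i j : ι} (hM : ExtCrit K e arr i j M X) (hN : ExtCrit K e arr i j N X) :
    ExtCrit K e arr i j (M × N) X := by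
  intro δ h1 h2
  obtain ⟨t, ht1, ht2⟩ := hM (fun a => δ a ∘ₗ LinearMap.inl K M N)
    (fun a m => by
      have := h1 a (m, 0)
      rw [Prod.smul_mk, smul_zero] at this
      exact this) (fun a m => h2 a _)
  obtain ⟨u, hu1, hu2⟩ := hN (fun a => δ a ∘ₗ LinearMap.inr K M N)
    (fun a m => by
      have := h1 a (0, m)
      rw [Prod.smul_mk, smul_zero] at this
      exact this) (fun a m => h2 a _)
  refine ⟨t.coprod u, fun k m => ?_, fun a m => ?_⟩
  · simp only [LinearMap.coprod_apply, Prod.smul_fst, Prod.smul_snd, ht1, hu1, smul_add]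
  · have h3 : δ a m = δ a (m.1, 0) + δ a (0, m.2) := by rw [← map_add]; simp
    have h4 := ht2 a m.1
    have h5 := hu2 a m.2
    simp only [LinearMap.comp_apply, LinearMap.inl_apply, LinearMap.inr_apply] at h4 h5
    rw [h3, h4, h5]
    simp only [LinearMap.coprod_apply, Prod.smul_fst, Prod.smul_snd, smul_add]
    abel

theorem ext1Vanish_of_extCrit [FiniteDimensional K Λ] (C : QData K Λ e Arr arr) {i j : ι}
    (hji : IsEmpty (Arr j i)) (hM : SuppIn e i j M) (hX : SuppIn e i j X)
    (h : ExtCrit K e arr i j M X) :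
    Ext1Vanish (ModuleCat.of Λᵐᵒᵖ M) (ModuleCat.of Λᵐᵒᵖ X) := by
  intro E f g hf hg hfg
  change X →ₗ[Λᵐᵒᵖ] E at f
  change E →ₗ[Λᵐᵒᵖ] M at g
  change Function.Injective f at hf
  change Function.Surjective g at hg
  let _ : Module K E := Module.compHom E (algebraMap K Λᵐᵒᵖ)
  have : IsScalarTower K Λᵐᵒᵖ E := IsScalarTower.of_algebraMap_smul fun _ _ => rfl
  have hE : SuppIn e i j E := hM.of_exact C hX f g hfg
  obtain ⟨s0, hs0⟩ := (toLin K g).exists_rightInverse_of_surjective (LinearMap.range_eq_top.2 hg)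
  have hs0 : ∀ m, g (s0 m) = m := fun m => LinearMap.congr_fun hs0 m
  let s1 : M →ₗ[K] E := ∑ k, actMap K E (e k) ∘ₗ s0 ∘ₗ actMap K M (e k)
  have hs1 : ∀ m, s1 m = ∑ k, op (e k) • s0 (op (e k) • m) := by
    intro m; simp [s1, actMap_apply]
  have hs1e : ∀ k m, s1 (op (e k) • m) = op (e k) • s1 m := by
    intro k m
    rw [hs1, hs1, Finset.smul_sum]
    refine Finset.sum_congr rfl fun l _ => ?_
    rw [idem_smul_idem_smul C, idem_smul_idem_smul C]
    by_cases hlk : l = k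
    · subst hlk; simp
    · rw [if_neg hlk, if_neg (Ne.symm hlk), map_zero, smul_zero]
  have hgs1 : ∀ m, g (s1 m) = m := by
    intro m
    rw [hs1, map_sum]
    conv_rhs => rw [← sum_idem_smul C m]
    refine Finset.sum_congr rfl fun l _ => ?_
    rw [map_smul, hs0, idem_smul_idem_smul C, if_pos rfl]
  have hδ : ∀ a m, op (arr i j a) • s1 m - s1 (op (arr i j a) • m) ∈
      LinearMap.range (toLin K f) := by
    intro a m
    have : op (arr i j a) • s1 m - s1 (op (arr i j a) • m) ∈ LinearMap.ker g := by
      rw [LinearMap.mem_ker, map_sub, map_smul, hgs1, hgs1, sub_self]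
    rw [← hfg] at this
    exact this
  let δ : Arr i j → M →ₗ[K] X := fun a =>
    (LinearEquiv.ofInjective (toLin K f) hf).symm.toLinearMap ∘ₗ LinearMap.codRestrict
      (LinearMap.range (toLin K f)) (actMap K E (arr i j a) ∘ₗ s1 - s1 ∘ₗ actMap K M (arr i j a))
      (hδ a)
  have hfδ : ∀ a m, f (δ a m) = op (arr i j a) • s1 m - s1 (op (arr i j a) • m) := by
    intro a m
    have := LinearEquiv.apply_symm_apply (LinearEquiv.ofInjective (toLin K f) hf)
      ⟨_, hδ a m⟩
    exact congrArg Subtype.val this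
  obtain ⟨t, ht1, ht2⟩ := h δ (fun a m => hf (by
      rw [hfδ, hfδ, hs1e, arr_smul_idem_smul C, arr_smul_idem_smul C, if_pos rfl, if_pos rfl]))
    (fun a m => hf (by
      rw [map_smul, hfδ, smul_sub, ← hs1e, idem_smul_arr_smul C, idem_smul_arr_smul C,
        if_pos rfl, if_pos rfl]))
  refine ⟨liftHom C (ll2_of_suppIn C hM) (ll2_of_suppIn C hE) (s1 - toLin K f ∘ₗ t)
    (fun k m => ?_) (fun k l b m => ?_), ?_⟩
  · simp only [LinearMap.sub_apply, LinearMap.comp_apply, toLin_apply, hs1e, ht1, map_smul,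
      smul_sub]
  · by_cases hkl : k = i ∧ l = j
    · obtain ⟨rfl, rfl⟩ := hkl
      have h1 := hfδ b m
      rw [ht2, map_sub, map_smul, eq_sub_iff_add_eq] at h1
      simp only [LinearMap.sub_apply, LinearMap.comp_apply, toLin_apply, smul_sub, ← h1]
      abel
    · have hkl' : ¬ (k = j ∧ l = i) := by rintro ⟨rfl, rfl⟩; exact hji.elim b
      rw [hM.arr_smul_eq_zero C b hkl hkl', hE.arr_smul_eq_zero C b hkl hkl', map_zero]
  · refine LinearMap.ext fun m => ?_
    change g (s1 m - f (t m)) = m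
    have : g (f (t m)) = 0 := by
      have : f (t m) ∈ LinearMap.ker g := by rw [← hfg]; exact ⟨_, rfl⟩
      exact this
    rw [map_sub, hgs1, this, sub_zero]

end Extensions

section InjGen

variable {Λ : Type} [Ring Λ] {ι : Type} {e : ι → Λ} {Arr : ι → ι → Type}
  [∀ i j, Fintype (Arr i j)] {arr : ∀ i j, Arr i j → Λ} {i j : ι}
  {M : Type} [AddCommGroup M] [Module Λᵐᵒᵖ M] {N : Type} [AddCommGroup N] [Module Λᵐᵒᵖ N]

/-- The arrows `i → j` act surjectively `M e_i → (M e_j)^m`. -/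
def InjP (e : ι → Λ) (arr : ∀ i j, Arr i j → Λ) (i j : ι) (M : Type) [AddCommGroup M]
    [Module Λᵐᵒᵖ M] : Prop :=
  ∀ w : Arr i j → M, ∃ y : M, ∀ a, op (arr i j a) • y = op (e j) • w a

/-- The arrows `i → j` act surjectively `(M e_i)^m → M e_j`. -/
def GenP (e : ι → Λ) (arr : ∀ i j, Arr i j → Λ) (i j : ι) (M : Type) [AddCommGroup M]
    [Module Λᵐᵒᵖ M] : Prop :=
  ∀ y : M, ∃ f : Arr i j → M, op (e j) • y = ∑ a, op (arr i j a) • f a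

theorem InjP.prod (hM : InjP e arr i j M) (hN : InjP e arr i j N) : InjP e arr i j (M × N) := by
  intro w
  obtain ⟨y, hy⟩ := hM fun a => (w a).1
  obtain ⟨z, hz⟩ := hN fun a => (w a).2
  exact ⟨(y, z), fun a => Prod.ext (hy a) (hz a)⟩

theorem InjP.pi (hM : InjP e arr i j M) (n : ℕ) : InjP e arr i j (Fin n → M) := by
  intro w
  choose y hy using fun t => hM fun a => w a t
  exact ⟨y, fun a => funext fun t => hy t a⟩

theorem InjP.of_surjective (hM : InjP e arr i j M) (f : M →ₗ[Λᵐᵒᵖ] N)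
    (hf : Function.Surjective f) : InjP e arr i j N := by
  intro w
  choose v hv using fun a => hf (w a)
  obtain ⟨y, hy⟩ := hM v
  exact ⟨f y, fun a => by rw [← map_smul, hy, map_smul, hv]⟩

theorem InjP.of_memFac {M X : Mdl Λᵐᵒᵖ} (hM : InjP e arr i j M) (h : MemFac M X) :
    InjP e arr i j X := by
  obtain ⟨n, f, hf⟩ := h
  exact (hM.pi n).of_surjective f hf

theorem GenP.prod (hM : GenP e arr i j M) (hN : GenP e arr i j N) : GenP e arr i j (M × N) := by
  intro y
  obtain ⟨f, hf⟩ := hM y.1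
  obtain ⟨g, hg⟩ := hN y.2
  refine ⟨fun a => (f a, g a), Prod.ext ?_ ?_⟩
  · rw [Prod.fst_sum]; exact hf
  · rw [Prod.snd_sum]; exact hg

theorem GenP.pi (hM : GenP e arr i j M) (n : ℕ) : GenP e arr i j (Fin n → M) := by
  intro y
  choose f hf using fun t => hM (y t)
  refine ⟨fun a t => f t a, funext fun t => ?_⟩
  rw [Finset.sum_apply]
  exact hf t

theorem GenP.of_surjective (hM : GenP e arr i j M) (f : M →ₗ[Λᵐᵒᵖ] N)
    (hf : Function.Surjective f) : GenP e arr i j N := by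
  intro y
  obtain ⟨x, rfl⟩ := hf y
  obtain ⟨g, hg⟩ := hM x
  exact ⟨fun a => f (g a), by rw [← map_smul, hg, map_sum]; simp only [map_smul]⟩

theorem GenP.of_memFac {M X : Mdl Λᵐᵒᵖ} (hM : GenP e arr i j M) (h : MemFac M X) :
    GenP e arr i j X := by
  obtain ⟨n, f, hf⟩ := h
  exact (hM.pi n).of_surjective f hf

end InjGen

theorem SuppIn.of_memFac {Λ : Type} [Ring Λ] {ι : Type} [Fintype ι] [DecidableEq ι] {e : ι → Λ}
    {i j : ι} {M X : Mdl Λᵐᵒᵖ} (hM : SuppIn e i j M) (h : MemFac M X) : SuppIn e i j X := by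
  obtain ⟨n, f, hf⟩ := h
  exact (hM.pi n).of_surjective f hf

section InjExt

variable {K : Type} [Field K] {Λ : Type} [Ring Λ] [Algebra K Λ]
  {ι : Type} [Fintype ι] [DecidableEq ι] {e : ι → Λ}
  {Arr : ι → ι → Type} [∀ i j, Fintype (Arr i j)] {arr : ∀ i j, Arr i j → Λ}
variable {M : Type} [AddCommGroup M] [Module Λᵐᵒᵖ M] [Module K M] [IsScalarTower K Λᵐᵒᵖ M]
variable {X : Type} [AddCommGroup X] [Module Λᵐᵒᵖ X] [Module K X] [IsScalarTower K Λᵐᵒᵖ X]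

theorem extCrit_of_injP (C : QData K Λ e Arr arr) {i j : ι} (hij : i ≠ j)
    (h : InjP e arr i j X) : ExtCrit K e arr i j M X := by
  intro δ h1 h2
  let B := Module.Basis.ofVectorSpace K M
  choose y hy using fun b => h fun a => δ a (B b)
  let T : M →ₗ[K] X := B.constr K fun b => op (e i) • y b
  have hT : ∀ m, op (e i) • T m = T m := by
    intro m
    suffices actMap K X (e i) ∘ₗ T = T from LinearMap.congr_fun this m
    refine B.ext fun b => ?_
    simp only [LinearMap.comp_apply, T, Module.Basis.constr_basis, actMap_apply,
      idem_smul_idem_smul C, if_true]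
  have hTa : ∀ a m, op (arr i j a) • T m = δ a m := by
    intro a m
    suffices actMap K X (arr i j a) ∘ₗ T = δ a from LinearMap.congr_fun this m
    refine B.ext fun b => ?_
    simp only [LinearMap.comp_apply, T, Module.Basis.constr_basis, actMap_apply,
      arr_smul_idem_smul C, if_true, hy, h2]
  refine ⟨T ∘ₗ actMap K M (e i), fun k m => ?_, fun a m => ?_⟩
  · simp only [LinearMap.comp_apply, actMap_apply, idem_smul_idem_smul C]
    rw [← hT (op (e i) • m), idem_smul_idem_smul C]
    by_cases hk : k = i
    · subst hk; simp only [if_true, hT]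
    · rw [if_neg hk, if_neg (Ne.symm hk), map_zero]
  · simp only [LinearMap.comp_apply, actMap_apply, idem_smul_arr_smul C, hTa, h1]
    rw [if_neg hij, map_zero, sub_zero]

theorem extCrit_of_forall_idem_smul_eq_zero {i j : ι}
    (hM : ∀ m : M, op (e i) • m = 0) : ExtCrit K e arr i j M X := by
  intro δ h1 _
  refine ⟨0, fun k m => by simp, fun a m => ?_⟩
  rw [← h1, hM]
  simp

end InjExt

section Kronecker

variable {K : Type} [Field K] {Λ : Type} [Ring Λ] [Algebra K Λ]
  {ι : Type} [Fintype ι] [DecidableEq ι] {e : ι → Λ}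
  {Arr : ι → ι → Type} [∀ i j, Fintype (Arr i j)] {arr : ∀ i j, Arr i j → Λ}

/-- The simple right module at the vertex `k`. -/
def Smp (_ : QData K Λ e Arr arr) (_ : ι) : Type := K

section Smp

variable (C : QData K Λ e Arr arr) (k : ι)

noncomputable instance : AddCommGroup (Smp C k) := inferInstanceAs (AddCommGroup K)
noncomputable instance : Module K (Smp C k) := inferInstanceAs (Module K K)
instance : Nontrivial (Smp C k) := inferInstanceAs (Nontrivial K)
instance : FiniteDimensional K (Smp C k) := inferInstanceAs (FiniteDimensional K K)

noncomputable instance : Module Λᵐᵒᵖ (Smp C k) where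
  smul x c := C.χ k x.unop • c
  one_smul c := by change C.χ k 1 • c = c; rw [C.χ_one, one_smul]
  mul_smul x y c := by
    change C.χ k (y.unop * x.unop) • c = C.χ k x.unop • C.χ k y.unop • c
    rw [C.χ_mul, mul_comm, mul_smul]
  smul_zero x := smul_zero (C.χ k x.unop)
  smul_add x := smul_add (C.χ k x.unop)
  add_smul x y c := by
    change C.χ k (x.unop + y.unop) • c = C.χ k x.unop • c + C.χ k y.unop • c
    rw [map_add, add_smul]
  zero_smul c := by change C.χ k 0 • c = 0; rw [map_zero, zero_smul]

theorem Smp.smul_def (x : Λ) (c : Smp C k) : op x • c = C.χ k x • c := rfl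

instance : IsScalarTower K Λᵐᵒᵖ (Smp C k) where
  smul_assoc c x s := by
    change C.χ k (c • x.unop) • s = c • C.χ k x.unop • s
    rw [map_smul, smul_eq_mul, mul_smul]

theorem Smp.idem_smul (l : ι) (c : Smp C k) : op (e l) • c = if l = k then c else 0 := by
  rw [Smp.smul_def, C.χ_idem]
  split_ifs with h1 h2 h2
  · rw [one_smul]
  · exact absurd h1.symm h2
  · exact absurd h2.symm h1
  · rw [zero_smul]

theorem Smp.arr_smul {i j : ι} (a : Arr i j) (c : Smp C k) : op (arr i j a) • c = 0 := by
  rw [Smp.smul_def, C.χ_arr, zero_smul]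

theorem Smp.suppIn_left (j : ι) : SuppIn e k j (Smp C k) :=
  fun l hl _ m => by rw [Smp.idem_smul, if_neg hl]

theorem Smp.suppIn_right (i : ι) : SuppIn e i k (Smp C k) :=
  fun l _ hl m => by rw [Smp.idem_smul, if_neg hl]

end Smp

variable {V W : Type} [AddCommGroup V] [Module K V] [AddCommGroup W] [Module K W]

/-- The right module attached to a representation of the arrows `i → j`. -/
def Kr (_ : QData K Λ e Arr arr) {i j : ι} (_ : Arr i j → V →ₗ[K] W) : Type := V × W

section Kr

variable (C : QData K Λ e Arr arr) {i j : ι} (α : Arr i j → V →ₗ[K] W)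

noncomputable instance : AddCommGroup (Kr C α) := inferInstanceAs (AddCommGroup (V × W))
noncomputable instance : Module K (Kr C α) := inferInstanceAs (Module K (V × W))
instance [FiniteDimensional K V] [FiniteDimensional K W] : FiniteDimensional K (Kr C α) :=
  inferInstanceAs (FiniteDimensional K (V × W))

/-- Elements of a representation. -/
def Kr.mk (v : V) (w : W) : Kr C α := (v, w)

theorem Kr.mk_add (v v' : V) (w w' : W) :
    Kr.mk C α (v + v') (w + w') = Kr.mk C α v w + Kr.mk C α v' w' := rfl

theorem Kr.smul_mk (c : K) (v : V) (w : W) : c • Kr.mk C α v w = Kr.mk C α (c • v) (c • w) := rfl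

theorem Kr.mk_zero : Kr.mk C α 0 0 = 0 := rfl

theorem Kr.mk_inj (v v' : V) (w w' : W) : Kr.mk C α v w = Kr.mk C α v' w' ↔ v = v' ∧ w = w' :=
  Prod.mk_inj

theorem Kr.exists_mk (m : Kr C α) : ∃ v w, m = Kr.mk C α v w := ⟨m.1, m.2, rfl⟩

noncomputable instance : Module Λᵐᵒᵖ (Kr C α) where
  smul x m := Kr.mk C α (C.χ i x.unop • m.1)
    (C.χ j x.unop • m.2 + ∑ a, C.ψ i j a x.unop • α a m.1)
  one_smul m := Prod.ext
    (by change C.χ i 1 • m.1 = m.1; rw [C.χ_one, one_smul])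
    (by
      change C.χ j 1 • m.2 + ∑ a, C.ψ i j a 1 • α a m.1 = m.2
      simp only [C.χ_one, one_smul, C.ψ_one, zero_smul, Finset.sum_const_zero, add_zero])
  mul_smul x y m := Prod.ext
    (by
      change C.χ i (y.unop * x.unop) • m.1 = C.χ i x.unop • C.χ i y.unop • m.1
      rw [C.χ_mul, mul_comm, mul_smul])
    (by
      change C.χ j (y.unop * x.unop) • m.2 + ∑ a, C.ψ i j a (y.unop * x.unop) • α a m.1 =
        C.χ j x.unop • (C.χ j y.unop • m.2 + ∑ a, C.ψ i j a y.unop • α a m.1) +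
          ∑ a, C.ψ i j a x.unop • α a (C.χ i y.unop • m.1)
      simp only [C.χ_mul, C.ψ_mul, add_smul, mul_smul, smul_add, Finset.sum_add_distrib,
        Finset.smul_sum, map_smul]
      rw [smul_comm, add_assoc]
      congr 1
      rw [add_comm]
      congr 1
      · exact Finset.sum_congr rfl fun a _ => smul_comm _ _ _
      · exact Finset.sum_congr rfl fun a _ => smul_comm _ _ _)
  smul_zero x := Prod.ext (smul_zero (C.χ i x.unop))
    (by
      change C.χ j x.unop • (0 : W) + ∑ a, C.ψ i j a x.unop • α a 0 = 0
      simp)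
  smul_add x m n := Prod.ext (smul_add (C.χ i x.unop) _ _)
    (by
      change C.χ j x.unop • (m.2 + n.2) + ∑ a, C.ψ i j a x.unop • α a (m.1 + n.1) =
        (C.χ j x.unop • m.2 + ∑ a, C.ψ i j a x.unop • α a m.1) +
        (C.χ j x.unop • n.2 + ∑ a, C.ψ i j a x.unop • α a n.1)
      simp only [smul_add, map_add, Finset.sum_add_distrib]
      abel)
  add_smul x y m := Prod.ext
    (by
      change C.χ i (x.unop + y.unop) • m.1 = C.χ i x.unop • m.1 + C.χ i y.unop • m.1
      rw [map_add, add_smul])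
    (by
      change C.χ j (x.unop + y.unop) • m.2 + ∑ a, C.ψ i j a (x.unop + y.unop) • α a m.1 =
        (C.χ j x.unop • m.2 + ∑ a, C.ψ i j a x.unop • α a m.1) +
        (C.χ j y.unop • m.2 + ∑ a, C.ψ i j a y.unop • α a m.1)
      simp only [add_smul, map_add, Finset.sum_add_distrib]
      abel)
  zero_smul m := Prod.ext
    (by change C.χ i 0 • m.1 = 0; rw [map_zero, zero_smul])
    (by
      change C.χ j 0 • m.2 + ∑ a, C.ψ i j a 0 • α a m.1 = 0
      simp)

theorem Kr.smul_def (x : Λ) (v : V) (w : W) : op x • Kr.mk C α v w =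
    Kr.mk C α (C.χ i x • v) (C.χ j x • w + ∑ a, C.ψ i j a x • α a v) := rfl

instance : IsScalarTower K Λᵐᵒᵖ (Kr C α) where
  smul_assoc c x m := Prod.ext
    (by
      change C.χ i (c • x.unop) • m.1 = c • C.χ i x.unop • m.1
      rw [map_smul, smul_eq_mul, mul_smul])
    (by
      change C.χ j (c • x.unop) • m.2 + ∑ a, C.ψ i j a (c • x.unop) • α a m.1 =
        c • (C.χ j x.unop • m.2 + ∑ a, C.ψ i j a x.unop • α a m.1)
      simp only [map_smul, smul_eq_mul, mul_smul, smul_add, Finset.smul_sum])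

theorem Kr.idem_smul (l : ι) (v : V) (w : W) : op (e l) • Kr.mk C α v w =
    Kr.mk C α (if l = i then v else 0) (if l = j then w else 0) := by
  simp only [Kr.smul_def, C.χ_idem, C.ψ_idem, zero_smul, Finset.sum_const_zero, add_zero,
    ite_smul, one_smul, eq_comm]

theorem Kr.arr_smul (a : Arr i j) (v : V) (w : W) : op (arr i j a) • Kr.mk C α v w =
    Kr.mk C α 0 (α a v) := by
  rw [Kr.smul_def, C.χ_arr, C.χ_arr, zero_smul, zero_smul, zero_add,
    Finset.sum_eq_single a (fun b _ hb => by rw [C.ψ_arr_ne i j b a hb, zero_smul]) (by simp),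
    C.ψ_arr_self, one_smul]

theorem Kr.suppIn : SuppIn e i j (Kr C α) := by
  intro l h1 h2 m
  obtain ⟨v, w, rfl⟩ := Kr.exists_mk C α m
  rw [Kr.idem_smul, if_neg h1, if_neg h2, Kr.mk_zero]

/-- Inclusion of the space at the source. -/
def Kr.inl : V →ₗ[K] Kr C α := LinearMap.inl K V W

/-- Inclusion of the space at the target. -/
def Kr.inr : W →ₗ[K] Kr C α := LinearMap.inr K V W

theorem Kr.inl_apply (v : V) : Kr.inl C α v = Kr.mk C α v 0 := rfl
theorem Kr.inr_apply (w : W) : Kr.inr C α w = Kr.mk C α 0 w := rfl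

theorem Kr.extCrit (hij : i ≠ j) {X : Type} [AddCommGroup X] [Module Λᵐᵒᵖ X] [Module K X]
    [IsScalarTower K Λᵐᵒᵖ X]
    (h : ∀ δ : Arr i j → V →ₗ[K] X, (∀ a v, op (e j) • δ a v = δ a v) →
      ∃ (f : V →ₗ[K] X) (g : W →ₗ[K] X), (∀ v, op (e i) • f v = f v) ∧
        (∀ w, op (e j) • g w = g w) ∧ ∀ a v, g (α a v) = op (arr i j a) • f v - δ a v) :
    ExtCrit K e arr i j (Kr C α) X := by
  intro δ h1 h2
  obtain ⟨f, g, hf, hg, hfg⟩ := h (fun a => δ a ∘ₗ Kr.inl C α) (fun a v => h2 a _)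
  have hδ : ∀ a v w, δ a (Kr.mk C α v w) = δ a (Kr.inl C α v) := by
    intro a v w
    rw [← h1, Kr.idem_smul, if_pos rfl, if_neg hij]; rfl
  refine ⟨f.coprod g, fun k m => ?_, fun a m => ?_⟩
  · obtain ⟨v, w, rfl⟩ := Kr.exists_mk C α m
    rw [Kr.idem_smul]
    change f (if k = i then v else 0) + g (if k = j then w else 0) = op (e k) • (f v + g w)
    rw [smul_add, ← hf v, ← hg w, idem_smul_idem_smul C, idem_smul_idem_smul C]
    by_cases h3 : k = i
    · subst h3; simp [hij, hf]
    · by_cases h4 : k = j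
      · subst h4; simp [hij.symm, hg]
      · simp [h3, h4]
  · obtain ⟨v, w, rfl⟩ := Kr.exists_mk C α m
    rw [Kr.arr_smul, hδ]
    change δ a _ = op (arr i j a) • (f v + g w) - (f 0 + g (α a v))
    rw [hfg, smul_add, ← hg w, arr_smul_idem_smul C, if_neg hij.symm, map_zero]
    simp

end Kr

end Kronecker

section Decomp

variable {A : Type} [Ring A] {M N : Type} [AddCommGroup M] [Module A M]
  [AddCommGroup N] [Module A N]

theorem isIndec_of_forall_smul {K : Type} [Field K] [Module K M] [Nontrivial M]
    (h : ∀ φ : M →ₗ[A] M, ∃ c : K, ∀ m, φ m = c • m) : IsIndec (ModuleCat.of A M) := by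
  refine ⟨‹Nontrivial M›, fun P P' hP => ?_⟩
  change Submodule A M at P P'
  obtain ⟨c, hc⟩ := h (P.projection P' hP)
  by_cases h0 : c = 0
  · left
    rw [eq_bot_iff]
    intro x hx
    have h1 := hc x
    rwa [h0, zero_smul, (Submodule.projection_eq_self_iff hP x).mpr hx] at h1
  · right
    rw [eq_bot_iff]
    intro x hx
    have h1 := hc x
    rw [(Submodule.projection_apply_eq_zero_iff hP).mpr hx] at h1
    exact (smul_eq_zero.mp h1.symm).resolve_left h0

theorem IsIndec.of_equiv (h : IsIndec (ModuleCat.of A M)) (φ : M ≃ₗ[A] N) :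
    IsIndec (ModuleCat.of A N) := by
  refine ⟨have := h.1; φ.symm.toEquiv.nontrivial, fun P P' hP => ?_⟩
  have h1 := h.2 _ _ ((Submodule.orderIsoMapComap φ).symm.isCompl hP)
  refine h1.imp ?_ ?_ <;> intro h2 <;> exact (map_eq_bot_iff _).mp h2

theorem isDecompOf_prod (hM : IsIndec (ModuleCat.of A M)) (hN : IsIndec (ModuleCat.of A N)) :
    IsDecompOf (ModuleCat.of A (M × N))
      ![LinearMap.range (LinearMap.inl A M N), LinearMap.range (LinearMap.inr A M N)] := by
  have hc : IsCompl (LinearMap.range (LinearMap.inl A M N))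
      (LinearMap.range (LinearMap.inr A M N)) := LinearMap.isCompl_range_inl_inr
  refine ⟨?_, ?_, ?_⟩
  · rw [iSupIndep_pair (i := 0) (j := 1) (by decide) (by decide)]
    exact hc.disjoint
  · rw [eq_top_iff]
    refine le_trans (codisjoint_iff_le_sup.mp hc.codisjoint) (sup_le ?_ ?_)
    · exact le_iSup_of_le (0 : Fin 2) le_rfl
    · exact le_iSup_of_le (1 : Fin 2) le_rfl
  · intro k
    fin_cases k
    · exact hM.of_equiv (LinearEquiv.ofInjective _ LinearMap.inl_injective)
    · exact hN.of_equiv (LinearEquiv.ofInjective _ LinearMap.inr_injective)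

theorem isBasicMod_prod (hM : IsIndec (ModuleCat.of A M)) (hN : IsIndec (ModuleCat.of A N))
    (hMN : IsEmpty (M ≃ₗ[A] N)) : IsBasicMod (ModuleCat.of A (M × N)) := by
  refine ⟨2, _, isDecompOf_prod hM hN, ?_⟩
  have key : IsEmpty (LinearMap.range (LinearMap.inl A M N) ≃ₗ[A]
      LinearMap.range (LinearMap.inr A M N)) :=
    ⟨fun φ => hMN.elim (((LinearEquiv.ofInjective _ LinearMap.inl_injective).trans φ).trans
      (LinearEquiv.ofInjective _ LinearMap.inr_injective).symm)⟩
  intro k l hkl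
  fin_cases k <;> fin_cases l
  · exact absurd rfl hkl
  · exact key
  · exact ⟨fun φ => key.elim φ.symm⟩
  · exact absurd rfl hkl

theorem isDecompOf_self (hM : IsIndec (ModuleCat.of A M)) :
    IsDecompOf (ModuleCat.of A M) (fun _ : Fin 1 => (⊤ : Submodule A M)) := by
  refine ⟨?_, ?_, fun k => hM.of_equiv Submodule.topEquiv.symm⟩
  · intro i
    have : ∀ j : Fin 1, ¬ j ≠ i := fun j h => h (Subsingleton.elim _ _)
    simp [this]
  · exact iSup_const

theorem isBasicMod_self (hM : IsIndec (ModuleCat.of A M)) : IsBasicMod (ModuleCat.of A M) :=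
  ⟨1, _, isDecompOf_self hM, fun _ _ h => absurd (Subsingleton.elim _ _) h⟩

theorem isDecompOf_zero (M : Mdl A) [Subsingleton M] :
    IsDecompOf M (fun _ : Fin 0 => (⊤ : Submodule A M)) := by
  refine ⟨fun i => i.elim0, ?_, fun k => k.elim0⟩
  exact Subsingleton.elim _ _

variable {Λ : Type} [Ring Λ] {ι : Type} [Fintype ι] {e : ι → Λ}
  {M N : Type} [AddCommGroup M] [Module Λᵐᵒᵖ M] [AddCommGroup N] [Module Λᵐᵒᵖ N]

theorem isBSTT_prod (hM : IsIndec (ModuleCat.of Λᵐᵒᵖ M)) (hN : IsIndec (ModuleCat.of Λᵐᵒᵖ N))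
    (hMN : IsEmpty (M ≃ₗ[Λᵐᵒᵖ] N)) (hτ : IsTauRigid (ModuleCat.of Λᵐᵒᵖ (M × N)))
    {i j : ι} (hij : i ≠ j) (hs : Supp Λ e (ModuleCat.of Λᵐᵒᵖ (M × N)) = {i, j}) :
    IsBSTT Λ e (ModuleCat.of Λᵐᵒᵖ (M × N)) := by
  refine ⟨⟨hτ.1, hτ, ?_⟩, isBasicMod_prod hM hN hMN⟩
  rw [hs, Set.ncard_pair hij]
  exact ⟨_, isDecompOf_prod hM hN⟩

theorem isBSTT_self (hM : IsIndec (ModuleCat.of Λᵐᵒᵖ M)) (hτ : IsTauRigid (ModuleCat.of Λᵐᵒᵖ M))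
    {i : ι} (hs : Supp Λ e (ModuleCat.of Λᵐᵒᵖ M) = {i}) :
    IsBSTT Λ e (ModuleCat.of Λᵐᵒᵖ M) := by
  refine ⟨⟨hτ.1, hτ, ?_⟩, isBasicMod_self hM⟩
  rw [hs, Set.ncard_singleton]
  exact ⟨_, isDecompOf_self hM⟩

theorem isBSTT_of_subsingleton (M : Mdl Λᵐᵒᵖ) [Subsingleton M] : IsBSTT Λ e M := by
  have hs : Supp Λ e M = ∅ :=
    Set.eq_empty_of_forall_notMem fun i ⟨m, hm⟩ => hm (Subsingleton.elim _ _)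
  have hfin : Module.Finite Λᵐᵒᵖ M := inferInstance
  refine ⟨⟨hfin, ⟨hfin, fun X _ E f g _ _ _ => ⟨0, ?_⟩⟩, ?_⟩,
    ⟨0, _, isDecompOf_zero M, fun k => k.elim0⟩⟩
  · exact LinearMap.ext fun m => Subsingleton.elim _ _
  · rw [hs, Set.ncard_empty]
    exact ⟨_, isDecompOf_zero M⟩

end Decomp

section Kronecker

variable {K : Type} [Field K] {Λ : Type} [Ring Λ] [Algebra K Λ]
  {ι : Type} [Fintype ι] [DecidableEq ι] {e : ι → Λ}
  {Arr : ι → ι → Type} [∀ i j, Fintype (Arr i j)] {arr : ∀ i j, Arr i j → Λ}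

section Hom

variable {V W : Type} [AddCommGroup V] [Module K V] [AddCommGroup W] [Module K W]
  {V' W' : Type} [AddCommGroup V'] [Module K V'] [AddCommGroup W'] [Module K W']
  (C : QData K Λ e Arr arr) {i j : ι} (α : Arr i j → V →ₗ[K] W) (β : Arr i j → V' →ₗ[K] W')

theorem Kr.mk_zero_sum {κ : Type} (s : Finset κ) (w : κ → W) :
    Kr.mk C α 0 (∑ a ∈ s, w a) = ∑ a ∈ s, Kr.mk C α 0 (w a) :=
  map_sum (Kr.inr C α) w s

theorem Kr.exists_hom (hij : i ≠ j) (φ : Kr C α →ₗ[Λᵐᵒᵖ] Kr C β) :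
    ∃ P : V →ₗ[K] V', (∀ v, φ (Kr.mk C α v 0) = Kr.mk C β (P v) 0) ∧
      ∀ a v, φ (Kr.mk C α 0 (α a v)) = Kr.mk C β 0 (β a (P v)) := by
  have key : ∀ v, φ (Kr.mk C α v 0) = Kr.mk C β (φ (Kr.mk C α v 0)).1 0 := by
    intro v
    have h1 : Kr.mk C α v 0 = op (e i) • Kr.mk C α v 0 := by
      rw [Kr.idem_smul, if_pos rfl, if_neg hij]
    obtain ⟨v', w', h2⟩ := Kr.exists_mk C β (φ (Kr.mk C α v 0))
    have h3 : φ (Kr.mk C α v 0) = op (e i) • Kr.mk C β v' w' := by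
      rw [← h2, ← map_smul, ← h1]
    rw [h3, Kr.idem_smul, if_pos rfl, if_neg hij]
    rfl
  let p : Kr C β →ₗ[K] V' := LinearMap.fst K V' W'
  refine ⟨p ∘ₗ toLin K φ ∘ₗ Kr.inl C α, key, fun a v => ?_⟩
  rw [← Kr.arr_smul C α a v 0, map_smul, key, Kr.arr_smul]
  rfl

theorem Kr.isIndec [Nontrivial V] (hij : i ≠ j) (hgen : ∀ w, ∃ f : Arr i j → V, w = ∑ a, α a (f a))
    (h : ∀ P : V →ₗ[K] V, (∀ f : Arr i j → V, ∑ a, α a (f a) = 0 → ∑ a, α a (P (f a)) = 0) →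
      ∃ c : K, ∀ v, P v = c • v) : IsIndec (ModuleCat.of Λᵐᵒᵖ (Kr C α)) := by
  have hnt : Nontrivial (Kr C α) := inferInstanceAs (Nontrivial (V × W))
  refine isIndec_of_forall_smul (K := K) fun φ => ?_
  obtain ⟨P, hP1, hP2⟩ := Kr.exists_hom C α α hij φ
  have hsum : ∀ f : Arr i j → V, φ (Kr.mk C α 0 (∑ a, α a (f a))) =
      Kr.mk C α 0 (∑ a, α a (P (f a))) := by
    intro f
    rw [Kr.mk_zero_sum, map_sum, Kr.mk_zero_sum]
    exact Finset.sum_congr rfl fun a _ => hP2 a (f a)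
  obtain ⟨c, hc⟩ := h P (fun f hf => by
    have h1 := hsum f
    rw [hf, Kr.mk_zero, map_zero, ← Kr.mk_zero, Kr.mk_inj] at h1
    exact h1.2.symm)
  refine ⟨c, fun m => ?_⟩
  obtain ⟨v, w, rfl⟩ := Kr.exists_mk C α m
  obtain ⟨f, rfl⟩ := hgen w
  have h1 : Kr.mk C α v (∑ a, α a (f a)) = Kr.mk C α v 0 + Kr.mk C α 0 (∑ a, α a (f a)) := by
    rw [← Kr.mk_add, add_zero, zero_add]
  rw [h1, map_add, hP1, hsum, ← Kr.mk_add, add_zero, zero_add, ← Kr.mk_add, add_zero, zero_add,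
    Kr.smul_mk, Finset.smul_sum]
  simp only [hc, map_smul]

theorem Kr.genP (hij : i ≠ j) (hgen : ∀ w, ∃ f : Arr i j → V, w = ∑ a, α a (f a)) :
    GenP e arr i j (Kr C α) := by
  intro y
  obtain ⟨v, w, rfl⟩ := Kr.exists_mk C α y
  obtain ⟨f, rfl⟩ := hgen w
  refine ⟨fun a => Kr.mk C α (f a) 0, ?_⟩
  rw [Kr.idem_smul, if_neg hij.symm, if_pos rfl, Kr.mk_zero_sum]
  exact Finset.sum_congr rfl fun a _ => (Kr.arr_smul C α a (f a) 0).symm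

end Hom

section Simple

variable (C : QData K Λ e Arr arr)

/-- The generator of the simple module. -/
def Smp.one (k : ι) : Smp C k := (1 : K)

theorem Smp.one_ne_zero (k : ι) : Smp.one C k ≠ 0 := _root_.one_ne_zero (α := K)

theorem Smp.isIndec (k : ι) : IsIndec (ModuleCat.of Λᵐᵒᵖ (Smp C k)) := by
  refine isIndec_of_forall_smul (K := K) fun φ => ?_
  refine ⟨(φ (1 : K) : K), fun m => ?_⟩
  have h := (toLin K φ).map_smul (show K from m) (show Smp C k from (1 : K))
  have h1 : (show K from m) • (show Smp C k from (1 : K)) = m := mul_one (show K from m)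
  rw [h1] at h
  refine h.trans ?_
  exact mul_comm (show K from m) _

theorem Smp.injP (i j : ι) (hij : i ≠ j) : InjP e arr i j (Smp C i) :=
  fun _ => ⟨0, fun _ => by rw [smul_zero, Smp.idem_smul, if_neg hij.symm]⟩

theorem Smp.not_injP (i j : ι) (a : Arr i j) : ¬ InjP e arr i j (Smp C j) := by
  intro h
  obtain ⟨y, hy⟩ := h fun _ => Smp.one C j
  have h1 := hy a
  rw [Smp.arr_smul, Smp.idem_smul, if_pos rfl] at h1
  exact Smp.one_ne_zero C j h1.symm

theorem Smp.not_genP (i j : ι) : ¬ GenP e arr i j (Smp C j) := by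
  intro h
  obtain ⟨f, hf⟩ := h (Smp.one C j)
  simp only [Smp.arr_smul, Smp.idem_smul, if_pos, Finset.sum_const_zero] at hf
  exact Smp.one_ne_zero C j hf

theorem Smp.exists_idem_smul_ne_zero (k : ι) : ∃ m : Smp C k, op (e k) • m ≠ 0 :=
  ⟨Smp.one C k, by rw [Smp.idem_smul, if_pos rfl]; exact Smp.one_ne_zero C k⟩

end Simple

variable [∀ i j, DecidableEq (Arr i j)]

section Maps

variable (K) {i j : ι}

/-- Structure maps of the indecomposable projective of a generalized Kronecker quiver. -/
def projArr (a : Arr i j) : K →ₗ[K] (Arr i j → K) := LinearMap.single K (fun _ => K) a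

/-- Structure maps of the indecomposable injective of a generalized Kronecker quiver. -/
def injArr (a : Arr i j) : (Arr i j → K) →ₗ[K] K := LinearMap.proj a

/-- Structure maps of the inverse translate of the simple projective of a generalized
Kronecker quiver. -/
def coArr (a : Arr i j) : (Arr i j → K) →ₗ[K]
    ((Arr i j → Arr i j → K) ⧸ Submodule.span K {fun a : Arr i j => (Pi.single a 1 : Arr i j → K)}) :=
  Submodule.mkQ _ ∘ₗ LinearMap.single K (fun _ => Arr i j → K) a

theorem projArr_gen (w : Arr i j → K) : ∃ f : Arr i j → K, w = ∑ a, projArr K a (f a) :=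
  ⟨w, (Finset.univ_sum_single w).symm⟩

theorem injArr_gen [Nonempty (Arr i j)] (w : K) :
    ∃ f : Arr i j → Arr i j → K, w = ∑ a, injArr K a (f a) := by
  obtain ⟨a⟩ := ‹Nonempty (Arr i j)›
  refine ⟨Pi.single a fun _ => w, ?_⟩
  rw [Finset.sum_eq_single a (fun b _ hb => by simp [hb]) (by simp), Pi.single_eq_same]
  rfl

theorem sum_coArr (f : Arr i j → Arr i j → K) :
    ∑ a, coArr K a (f a) = Submodule.mkQ _ f := by
  conv_rhs => rw [← Finset.univ_sum_single f, map_sum]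
  rfl

theorem coArr_gen (w) : ∃ f : Arr i j → Arr i j → K, w = ∑ a, coArr K a (f a) := by
  obtain ⟨f, rfl⟩ := Submodule.mkQ_surjective _ w
  exact ⟨f, (sum_coArr K f).symm⟩

theorem projArr_brick (P : K →ₗ[K] K) : ∃ c : K, ∀ v, P v = c • v := by
  refine ⟨P 1, fun v => ?_⟩
  rw [← mul_one v, ← smul_eq_mul, map_smul]
  simp [mul_comm]

theorem injArr_brick [Nonempty (Arr i j)] (P : (Arr i j → K) →ₗ[K] (Arr i j → K))
    (h : ∀ f : Arr i j → Arr i j → K, ∑ a, injArr K a (f a) = 0 → ∑ a, injArr K a (P (f a)) = 0) :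
    ∃ c : K, ∀ v, P v = c • v := by
  obtain ⟨a₀⟩ := ‹Nonempty (Arr i j)›
  have hker : ∀ (b : Arr i j) (v : Arr i j → K), v b = 0 → P v b = 0 := by
    intro b v hv
    have h1 := h (Pi.single b v)
    rw [Finset.sum_eq_single b (fun b' _ hb => by simp [hb]) (by simp),
      Finset.sum_eq_single b (fun b' _ hb => by simp [hb]) (by simp), Pi.single_eq_same] at h1
    exact h1 hv
  have hdiag : ∀ b : Arr i j, P (Pi.single b 1) b = P (Pi.single a₀ 1) a₀ := by
    intro b
    by_cases hb : b = a₀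
    · rw [hb]
    have h1 := h (Pi.single b (Pi.single b 1) - Pi.single a₀ (Pi.single a₀ 1))
    simp only [Pi.sub_apply, map_sub, Finset.sum_sub_distrib] at h1
    rw [Finset.sum_eq_single b (fun b' _ hb => by simp [hb]) (by simp),
      Finset.sum_eq_single a₀ (fun b' _ hb => by simp [hb]) (by simp),
      Finset.sum_eq_single b (fun b' _ hb => by simp [hb]) (by simp),
      Finset.sum_eq_single a₀ (fun b' _ hb => by simp [hb]) (by simp)] at h1
    simp only [Pi.single_eq_same] at h1
    refine sub_eq_zero.mp (h1 ?_)
    simp [injArr]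
  refine ⟨P (Pi.single a₀ 1) a₀, fun v => funext fun b => ?_⟩
  have h1 := hker b (v - v b • Pi.single b 1) (by simp)
  rw [map_sub, map_smul, Pi.sub_apply, Pi.smul_apply, hdiag, sub_eq_zero] at h1
  rw [h1, Pi.smul_apply, smul_eq_mul, smul_eq_mul, mul_comm]

theorem coArr_brick (P : (Arr i j → K) →ₗ[K] (Arr i j → K))
    (h : ∀ f : Arr i j → Arr i j → K, ∑ a, coArr K a (f a) = 0 → ∑ a, coArr K a (P (f a)) = 0) :
    ∃ c : K, ∀ v, P v = c • v := by
  have h1 := h (fun a => Pi.single a 1)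
  rw [sum_coArr, sum_coArr, Submodule.mkQ_apply, Submodule.mkQ_apply,
    Submodule.Quotient.mk_eq_zero, Submodule.Quotient.mk_eq_zero] at h1
  obtain ⟨c, hc⟩ := Submodule.mem_span_singleton.mp (h1 (Submodule.mem_span_singleton_self _))
  refine ⟨c, fun v => ?_⟩
  have h2 : P = c • LinearMap.id := by
    refine LinearMap.pi_ext' fun a => LinearMap.ext_ring ?_
    simpa using (congrFun hc a).symm
  rw [h2]
  rfl

end Maps

end Kronecker

section Kronecker

variable {K : Type} [Field K] {Λ : Type} [Ring Λ] [Algebra K Λ]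
  {ι : Type} [Fintype ι] [DecidableEq ι] {e : ι → Λ}
  {Arr : ι → ι → Type} [∀ i j, Fintype (Arr i j)] {arr : ∀ i j, Arr i j → Λ}
  [∀ i j, DecidableEq (Arr i j)] (C : QData K Λ e Arr arr) (i j : ι)

/-- The projective at `i` over the generalized Kronecker quiver with arrows `Arr i j`. -/
abbrev PKr : Type := Kr C (projArr K (i := i) (j := j))
/-- The injective at `j` over the generalized Kronecker quiver with arrows `Arr i j`. -/
abbrev IKr : Type := Kr C (injArr K (i := i) (j := j))
/-- The second preprojective over the generalized Kronecker quiver with arrows `Arr i j`. -/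
abbrev CKr : Type := Kr C (coArr K (i := i) (j := j))

variable {i j}

theorem PKr.isIndec (hij : i ≠ j) : IsIndec (ModuleCat.of Λᵐᵒᵖ (PKr C i j)) :=
  Kr.isIndec C _ hij (projArr_gen K) fun P _ => projArr_brick K P

theorem IKr.isIndec (hij : i ≠ j) [Nonempty (Arr i j)] :
    IsIndec (ModuleCat.of Λᵐᵒᵖ (IKr C i j)) :=
  Kr.isIndec C _ hij (injArr_gen K) (injArr_brick K)

theorem CKr.isIndec (hij : i ≠ j) [Nonempty (Arr i j)] :
    IsIndec (ModuleCat.of Λᵐᵒᵖ (CKr C i j)) :=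
  Kr.isIndec C _ hij (coArr_gen K) (coArr_brick K)

theorem PKr.genP (hij : i ≠ j) : GenP e arr i j (PKr C i j) := Kr.genP C _ hij (projArr_gen K)

theorem CKr.genP (hij : i ≠ j) : GenP e arr i j (CKr C i j) := Kr.genP C _ hij (coArr_gen K)

theorem IKr.injP (hij : i ≠ j) : InjP e arr i j (IKr C i j) := by
  intro w
  refine ⟨Kr.mk C _ (fun a => (w a).2) 0, fun a => ?_⟩
  obtain ⟨v', w', h⟩ := Kr.exists_mk C _ (w a)
  rw [Kr.arr_smul, h, Kr.idem_smul, if_neg hij.symm, if_pos rfl]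
  change Kr.mk C _ 0 (w a).2 = _
  rw [h]
  rfl

theorem PKr.not_injP (hij : i ≠ j) {a b : Arr i j} (hab : a ≠ b) :
    ¬ InjP e arr i j (PKr C i j) := by
  intro h
  obtain ⟨y, hy⟩ := h fun _ => Kr.mk C _ 0 (Pi.single b 1)
  obtain ⟨v, w, rfl⟩ := Kr.exists_mk C _ y
  have h1 := hy a
  rw [Kr.arr_smul, Kr.idem_smul, if_neg hij.symm, if_pos rfl, Kr.mk_inj] at h1
  have h2 := congrFun h1.2 b
  simp [projArr, hab.symm] at h2

section Ext

variable {X : Type} [AddCommGroup X] [Module Λᵐᵒᵖ X] [Module K X] [IsScalarTower K Λᵐᵒᵖ X]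

theorem PKr.extCrit (hij : i ≠ j) : ExtCrit K e arr i j (PKr C i j) X := by
  refine Kr.extCrit C _ hij fun δ hδ => ?_
  let g : (Arr i j → K) →ₗ[K] X := -∑ a, (LinearMap.proj a : (Arr i j → K) →ₗ[K] K).smulRight (δ a 1)
  have hg : ∀ w, g w = -∑ a, w a • δ a 1 := fun w => by simp [g]
  refine ⟨0, g, by simp, fun w => ?_, fun a v => ?_⟩
  · rw [hg, smul_neg, Finset.smul_sum]
    exact congrArg _ (Finset.sum_congr rfl fun a _ => by rw [smul_comm, hδ])
  · rw [hg, Finset.sum_eq_single a (fun b _ hb => by simp [projArr, hb]) (by simp)]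
    simp only [projArr, LinearMap.coe_single, Pi.single_eq_same, LinearMap.zero_apply, smul_zero,
      zero_sub, ← map_smul, smul_eq_mul, mul_one]

theorem CKr.extCrit (hij : i ≠ j) (h : GenP e arr i j X) : ExtCrit K e arr i j (CKr C i j) X := by
  refine Kr.extCrit C _ hij fun δ hδ => ?_
  obtain ⟨F, hF⟩ := h (∑ a, δ a (Pi.single a 1))
  have hF' : ∑ a, δ a (Pi.single a 1) = ∑ a, op (arr i j a) • F a := by
    rw [← hF, Finset.smul_sum]
    exact Finset.sum_congr rfl fun a _ => (hδ _ _).symm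
  let f : (Arr i j → K) →ₗ[K] X :=
    ∑ a, (LinearMap.proj a : (Arr i j → K) →ₗ[K] K).smulRight (op (e i) • F a)
  have hf : ∀ v, f v = ∑ a, v a • op (e i) • F a := fun v => by simp [f]
  have hf1 : ∀ a, f (Pi.single a 1) = op (e i) • F a := by
    intro a
    rw [hf, Finset.sum_eq_single a (fun b _ hb => by simp [hb]) (by simp)]
    simp
  let G : (Arr i j → Arr i j → K) →ₗ[K] X :=
    ∑ a, (actMap K X (arr i j a) ∘ₗ f - δ a) ∘ₗ LinearMap.proj a
  have hG : ∀ x, G x = ∑ a, (op (arr i j a) • f (x a) - δ a (x a)) := fun x => by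
    simp [G, actMap_apply]
  have hG0 : Submodule.span K {fun a : Arr i j => (Pi.single a 1 : Arr i j → K)} ≤
      LinearMap.ker G := by
    rw [Submodule.span_singleton_le_iff_mem, LinearMap.mem_ker, hG, Finset.sum_sub_distrib, hF',
      sub_eq_zero]
    refine Finset.sum_congr rfl fun a _ => ?_
    rw [hf1, arr_smul_idem_smul C, if_pos rfl]
  refine ⟨f, Submodule.liftQ _ G hG0, fun v => ?_, fun w => ?_, fun a v => ?_⟩
  · rw [hf, Finset.smul_sum]
    exact Finset.sum_congr rfl fun a _ => by
      rw [smul_comm, idem_smul_idem_smul C, if_pos rfl]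
  · obtain ⟨x, rfl⟩ := Submodule.mkQ_surjective _ w
    rw [Submodule.mkQ_apply, Submodule.liftQ_apply, hG, Finset.smul_sum]
    exact Finset.sum_congr rfl fun a _ => by
      rw [smul_sub, hδ, idem_smul_arr_smul C, if_pos rfl]
  · change Submodule.liftQ _ G hG0 (Submodule.Quotient.mk (Pi.single a v)) = _
    rw [Submodule.liftQ_apply, hG,
      Finset.sum_eq_single a (fun b _ hb => by simp [hb]) (by simp), Pi.single_eq_same]

end Ext

theorem isEmpty_smp_equiv_iKr (hij : i ≠ j) : IsEmpty (Smp C i ≃ₗ[Λᵐᵒᵖ] IKr C i j) := by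
  refine ⟨fun φ => ?_⟩
  have h1 : op (e j) • Kr.mk C (injArr K (i := i) (j := j)) 0 1 = 0 := by
    rw [← φ.apply_symm_apply (Kr.mk C _ 0 1), ← map_smul, Smp.idem_smul, if_neg hij.symm, map_zero]
  rw [Kr.idem_smul, if_pos rfl, if_neg hij.symm, ← Kr.mk_zero, Kr.mk_inj] at h1
  exact one_ne_zero h1.2

theorem isEmpty_pKr_equiv_smp (hij : i ≠ j) : IsEmpty (PKr C i j ≃ₗ[Λᵐᵒᵖ] Smp C j) := by
  refine ⟨fun φ => ?_⟩
  have h1 : φ (op (e i) • Kr.mk C _ 1 0) = 0 := by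
    rw [map_smul, Smp.idem_smul, if_neg hij]
  rw [φ.map_eq_zero_iff, Kr.idem_smul, if_pos rfl, if_neg hij, ← Kr.mk_zero, Kr.mk_inj] at h1
  exact one_ne_zero h1.1

theorem isEmpty_pKr_equiv_cKr (hij : i ≠ j) (a : Arr i j) :
    IsEmpty (PKr C i j ≃ₗ[Λᵐᵒᵖ] CKr C i j) := by
  refine ⟨fun φ => ?_⟩
  obtain ⟨P, hP1, hP2⟩ := Kr.exists_hom C _ _ hij φ.symm.toLinearMap
  have h0 : ∑ a, coArr K a (Pi.single a 1 : Arr i j → K) = 0 := by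
    rw [sum_coArr]
    exact (Submodule.Quotient.mk_eq_zero _).mpr (Submodule.mem_span_singleton_self _)
  have h1 : ∑ a, projArr K a (P (Pi.single a 1 : Arr i j → K)) = 0 := by
    have h2 : Kr.mk C (projArr K (i := i) (j := j)) 0
        (∑ a, projArr K a (P (Pi.single a 1 : Arr i j → K))) = 0 := by
      rw [Kr.mk_zero_sum, Finset.sum_congr rfl fun a _ => (hP2 a _).symm, ← map_sum,
        ← Kr.mk_zero_sum, h0, Kr.mk_zero, map_zero]
    rw [← Kr.mk_zero, Kr.mk_inj] at h2
    exact h2.2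
  have h3 : P (Pi.single a 1) = 0 := by
    have h4 : ∑ b, projArr K b (P (Pi.single b 1 : Arr i j → K)) =
        fun b => P (Pi.single b 1) := Finset.univ_sum_single _
    rw [h4] at h1
    exact congrFun h1 a
  have h5 := hP1 (Pi.single a 1)
  rw [h3, Kr.mk_zero] at h5
  have h6 := φ.symm.map_eq_zero_iff.mp h5
  rw [← Kr.mk_zero, Kr.mk_inj] at h6
  have h7 := congrFun h6.1 a
  simp at h7

end Kronecker

section Supp

variable {Λ : Type} [Ring Λ] {ι : Type} [Fintype ι] {e : ι → Λ}
  {M : Type} [AddCommGroup M] [Module Λᵐᵒᵖ M]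

theorem supp_eq_pair {i j : ι} (h : SuppIn e i j M) (hi : ∃ m : M, op (e i) • m ≠ 0)
    (hj : ∃ m : M, op (e j) • m ≠ 0) : Supp Λ e (ModuleCat.of Λᵐᵒᵖ M) = {i, j} := by
  ext k
  constructor
  · rintro ⟨m, hm⟩
    by_contra hk
    rw [Set.mem_insert_iff, Set.mem_singleton_iff, not_or] at hk
    exact hm (h k hk.1 hk.2 m)
  · rintro (rfl | rfl)
    · exact hi
    · exact hj

end Supp

section BSTT

variable {K : Type} [Field K] {Λ : Type} [Ring Λ] [Algebra K Λ] [FiniteDimensional K Λ]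
  {ι : Type} [Fintype ι] [DecidableEq ι] {e : ι → Λ}
  {Arr : ι → ι → Type} [∀ i j, Fintype (Arr i j)] {arr : ∀ i j, Arr i j → Λ}
  (C : QData K Λ e Arr arr) {i j : ι}

theorem isTauRigid_of_extCrit (C : QData K Λ e Arr arr) {M : Type} [AddCommGroup M] [Module Λᵐᵒᵖ M] [Module K M]
    [IsScalarTower K Λᵐᵒᵖ M] [FiniteDimensional K M]
    (hji : IsEmpty (Arr j i)) (hM : SuppIn e i j M)
    (h : ∀ (X : Type) [AddCommGroup X] [Module Λᵐᵒᵖ X] [Module K X] [IsScalarTower K Λᵐᵒᵖ X],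
      MemFac (ModuleCat.of Λᵐᵒᵖ M) (ModuleCat.of Λᵐᵒᵖ X) → ExtCrit K e arr i j M X) :
    IsTauRigid (ModuleCat.of Λᵐᵒᵖ M) := by
  refine ⟨Module.Finite.of_restrictScalars_finite K Λᵐᵒᵖ M, fun X hX => ?_⟩
  let _ : Module K X := Module.compHom X (algebraMap K Λᵐᵒᵖ)
  have : IsScalarTower K Λᵐᵒᵖ X := IsScalarTower.of_algebraMap_smul fun _ _ => rfl
  have hs : SuppIn e i j (ModuleCat.of Λᵐᵒᵖ M) := hM
  exact ext1Vanish_of_extCrit C hji hM (hs.of_memFac hX) (h X hX)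

theorem Smp.isBSTT (k : ι) : IsBSTT Λ e (ModuleCat.of Λᵐᵒᵖ (Smp C k)) := by
  have hkk : IsEmpty (Arr k k) := ⟨C.not_loop k⟩
  refine isBSTT_self (Smp.isIndec C k) (isTauRigid_of_extCrit C hkk (Smp.suppIn_left C k k) ?_)
    (i := k) ?_
  · intro X _ _ _ _ hX δ _ _
    exact ⟨0, fun k m => by simp, fun a => hkk.elim a⟩
  · rw [supp_eq_pair (Smp.suppIn_left C k k) (Smp.exists_idem_smul_ne_zero C k)
      (Smp.exists_idem_smul_ne_zero C k), Set.pair_eq_singleton]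

variable [∀ i j, DecidableEq (Arr i j)]

theorem isBSTT_pKr_smp (hij : i ≠ j) (hji : IsEmpty (Arr j i)) :
    IsBSTT Λ e (ModuleCat.of Λᵐᵒᵖ (PKr C i j × Smp C j)) := by
  have hs : SuppIn e i j (PKr C i j × Smp C j) :=
    (Kr.suppIn C _).prod (Smp.suppIn_right C j i)
  refine isBSTT_prod (PKr.isIndec C hij) (Smp.isIndec C j) (isEmpty_pKr_equiv_smp C hij)
    (isTauRigid_of_extCrit C hji hs fun X _ _ _ _ _ => (PKr.extCrit C hij).prod
      (extCrit_of_forall_idem_smul_eq_zero fun m => ?_)) hij (supp_eq_pair hs ?_ ?_)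
  · rw [Smp.idem_smul, if_neg hij]
  · refine ⟨(Kr.mk C _ 1 0, 0), fun h => ?_⟩
    have h1 := congrArg Prod.fst h
    rw [Prod.smul_fst, Kr.idem_smul, if_pos rfl, if_neg hij] at h1
    exact one_ne_zero ((Kr.mk_inj C _ _ _ _ _).mp h1).1
  · refine ⟨(0, Smp.one C j), fun h => ?_⟩
    have h1 := congrArg Prod.snd h
    rw [Prod.smul_snd, Smp.idem_smul, if_pos rfl] at h1
    exact Smp.one_ne_zero C j h1

theorem isBSTT_smp_iKr (hij : i ≠ j) [Nonempty (Arr i j)] (hji : IsEmpty (Arr j i)) :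
    IsBSTT Λ e (ModuleCat.of Λᵐᵒᵖ (Smp C i × IKr C i j)) := by
  have hs : SuppIn e i j (Smp C i × IKr C i j) :=
    (Smp.suppIn_left C i j).prod (Kr.suppIn C _)
  refine isBSTT_prod (Smp.isIndec C i) (IKr.isIndec C hij) (isEmpty_smp_equiv_iKr C hij)
    (isTauRigid_of_extCrit C hji hs fun X _ _ _ _ hX => extCrit_of_injP C hij
      (InjP.of_memFac (M := ModuleCat.of Λᵐᵒᵖ (Smp C i × IKr C i j))
        ((Smp.injP C i j hij).prod (IKr.injP C hij)) hX)) hij (supp_eq_pair hs ?_ ?_)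
  · refine ⟨(Smp.one C i, 0), fun h => ?_⟩
    have h1 := congrArg Prod.fst h
    rw [Prod.smul_fst, Smp.idem_smul, if_pos rfl] at h1
    exact Smp.one_ne_zero C i h1
  · refine ⟨(0, Kr.mk C _ 0 1), fun h => ?_⟩
    have h1 := congrArg Prod.snd h
    rw [Prod.smul_snd, Kr.idem_smul, if_pos rfl, if_neg hij.symm] at h1
    exact one_ne_zero ((Kr.mk_inj C _ _ _ _ _).mp h1).2

theorem isBSTT_pKr_cKr (hij : i ≠ j) (a : Arr i j) (hji : IsEmpty (Arr j i)) :
    IsBSTT Λ e (ModuleCat.of Λᵐᵒᵖ (PKr C i j × CKr C i j)) := by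
  have : Nonempty (Arr i j) := ⟨a⟩
  have hs : SuppIn e i j (PKr C i j × CKr C i j) := (Kr.suppIn C _).prod (Kr.suppIn C _)
  refine isBSTT_prod (PKr.isIndec C hij) (CKr.isIndec C hij) (isEmpty_pKr_equiv_cKr C hij a)
    (isTauRigid_of_extCrit C hji hs fun X _ _ _ _ hX => (PKr.extCrit C hij).prod
      (CKr.extCrit C hij (GenP.of_memFac (M := ModuleCat.of Λᵐᵒᵖ (PKr C i j × CKr C i j))
        ((PKr.genP C hij).prod (CKr.genP C hij)) hX))) hij (supp_eq_pair hs ?_ ?_)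
  · refine ⟨(Kr.mk C _ 1 0, 0), fun h => ?_⟩
    have h1 := congrArg Prod.fst h
    rw [Prod.smul_fst, Kr.idem_smul, if_pos rfl, if_neg hij] at h1
    exact one_ne_zero ((Kr.mk_inj C _ _ _ _ _).mp h1).1
  · refine ⟨(Kr.mk C _ 0 (Pi.single a 1), 0), fun h => ?_⟩
    have h1 := congrArg Prod.fst h
    rw [Prod.smul_fst, Kr.idem_smul, if_pos rfl, if_neg hij.symm] at h1
    have h2 := congrFun ((Kr.mk_inj C _ _ _ _ _).mp h1).2 a
    simp at h2

end BSTT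

section Fac

variable {A : Type} [Ring A]

theorem memFac_of_surjective {M X : Mdl A} (f : M →ₗ[A] X) (hf : Function.Surjective f) :
    MemFac M X :=
  ⟨1, f ∘ₗ LinearMap.proj 0, hf.comp fun m => ⟨fun _ => m, rfl⟩⟩

theorem memFac_refl (M : Mdl A) : MemFac M M :=
  memFac_of_surjective LinearMap.id Function.surjective_id

theorem memFac_of_iSup_range {M X : Mdl A} [Module.Finite A X]
    (h : ⨆ f : M →ₗ[A] X, LinearMap.range f = ⊤) : MemFac M X := by
  have hc : IsCompactElement (⊤ : Submodule A X) :=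
    (Submodule.fg_iff_compact _).mp Module.Finite.fg_top
  obtain ⟨s, hs⟩ := (CompleteLattice.isCompactElement_iff_exists_le_iSup_of_le_iSup _).mp hc _
    (fun f : M →ₗ[A] X => LinearMap.range f) h.ge
  let g : Fin s.card → M →ₗ[A] X := fun k => (s.equivFin.symm k).1
  refine ⟨s.card, ∑ k, g k ∘ₗ LinearMap.proj k, fun x => ?_⟩
  have hx : x ∈ LinearMap.range (∑ k, g k ∘ₗ LinearMap.proj k) := by
    refine (hs.trans (Finset.sup_le fun f hf => ?_)) (Submodule.mem_top (x := x))
    rintro _ ⟨m, rfl⟩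
    refine ⟨Pi.single (s.equivFin ⟨f, hf⟩) m, ?_⟩
    rw [LinearMap.sum_apply, Finset.sum_eq_single (s.equivFin ⟨f, hf⟩)]
    · simp [g]
    · intro b _ hb
      simp [hb]
    · simp
  exact hx

theorem MemFac.trans {M N X : Mdl A} (h1 : MemFac M N) (h2 : MemFac N X) : MemFac M X := by
  obtain ⟨n, f, hf⟩ := h1
  obtain ⟨k, g, hg⟩ := h2
  let F : (Fin k → Fin n → M) →ₗ[A] X := g ∘ₗ LinearMap.pi fun t => f ∘ₗ LinearMap.proj t
  have hF : Function.Surjective F := hg.comp fun y => by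
    choose m hm using fun t => hf (y t)
    exact ⟨m, funext hm⟩
  let φ : (Fin (k * n) → M) ≃ₗ[A] (Fin k → Fin n → M) :=
    (LinearEquiv.funCongrLeft A M finProdFinEquiv).trans (LinearEquiv.curry A M (Fin k) (Fin n))
  exact ⟨k * n, F ∘ₗ φ.toLinearMap, hF.comp φ.surjective⟩

theorem facLE_iff {M N : Mdl A} : FacLE M N ↔ MemFac N M :=
  ⟨fun h => h M (memFac_refl M), fun h _ hX => h.trans hX⟩

theorem FacLE.trans {L M N : Mdl A} (h1 : FacLE L M) (h2 : FacLE M N) : FacLE L N :=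
  fun X hX => h2 X (h1 X hX)

theorem subsingleton_of_memFac {M X : Mdl A} [Subsingleton M] (h : MemFac M X) :
    Subsingleton X := by
  obtain ⟨n, f, hf⟩ := h
  exact hf.subsingleton

theorem memFac_of_subsingleton {M X : Mdl A} [Subsingleton X] : MemFac M X :=
  memFac_of_surjective 0 fun _ => ⟨0, Subsingleton.elim _ _⟩

/-- `Ext¹`-vanishing allows to lift maps along quotient maps. -/
theorem Ext1Vanish.exists_lift {T X : Mdl A} {N : Submodule A X}
    (h : Ext1Vanish T (ModuleCat.of A N)) (f : T →ₗ[A] X ⧸ N) :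
    ∃ g : T →ₗ[A] X, ∀ t, N.mkQ (g t) = f t := by
  let E : Submodule A (T × X) :=
    LinearMap.eqLocus (f ∘ₗ LinearMap.fst A T X) (N.mkQ ∘ₗ LinearMap.snd A T X)
  have hE : ∀ p : T × X, p ∈ E ↔ f p.1 = N.mkQ p.2 := fun p => Iff.rfl
  let inc : N →ₗ[A] E := LinearMap.codRestrict E (LinearMap.inr A T X ∘ₗ N.subtype) (fun x => by
    rw [hE]
    change f 0 = N.mkQ x.1
    rw [map_zero, Submodule.mkQ_apply, eq_comm, Submodule.Quotient.mk_eq_zero]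
    exact x.2)
  let pr : E →ₗ[A] T := LinearMap.fst A T X ∘ₗ E.subtype
  obtain ⟨s, hs⟩ := h (ModuleCat.of A E) inc pr
    (fun x y hxy => by
      have h1 := congrArg (fun z : E => z.1.2) hxy
      exact Subtype.ext h1)
    (fun t => by
      obtain ⟨x, hx⟩ := N.mkQ_surjective (f t)
      exact ⟨⟨(t, x), hx.symm⟩, rfl⟩)
    (by
      ext p
      constructor
      · rintro ⟨x, rfl⟩
        exact rfl
      · intro hp
        have hp1 : p.1.1 = 0 := hp
        have hp2 : f p.1.1 = N.mkQ p.1.2 := p.2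
        rw [hp1, map_zero, eq_comm, Submodule.mkQ_apply, Submodule.Quotient.mk_eq_zero] at hp2
        exact ⟨⟨p.1.2, hp2⟩, Subtype.ext (Prod.ext hp1.symm rfl)⟩)
  change T →ₗ[A] E at s
  refine ⟨LinearMap.snd A T X ∘ₗ E.subtype ∘ₗ s, fun t => ?_⟩
  have h1 : f (s t).1.1 = N.mkQ (s t).1.2 := (s t).2
  have h2 : (s t).1.1 = t := LinearMap.congr_fun hs t
  rw [h2] at h1
  exact h1.symm

/-- `Fac T` is closed under extensions for a `τ`-rigid module `T`. -/
theorem IsTauRigid.memFac_of_submodule {T X : Mdl A} (hT : IsTauRigid T) (N : Submodule A X)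
    (hN : MemFac T (ModuleCat.of A N)) (hQ : MemFac T (ModuleCat.of A (X ⧸ N))) : MemFac T X := by
  obtain ⟨n, f, hf⟩ := hQ
  change (Fin n → T) →ₗ[A] X ⧸ N at f
  change Function.Surjective f at hf
  have hext := hT.2 _ hN
  obtain ⟨k, g, hg⟩ := hN
  change (Fin k → T) →ₗ[A] N at g
  change Function.Surjective g at hg
  choose l hl using fun t : Fin n => hext.exists_lift (f ∘ₗ LinearMap.single A (fun _ => T) t)
  let L : (Fin n → T) →ₗ[A] X := ∑ t, l t ∘ₗ LinearMap.proj t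
  have hL : ∀ v, N.mkQ (L v) = f v := by
    intro v
    have h1 : f v = ∑ t, f (Pi.single t (v t)) := by
      rw [← map_sum, Finset.univ_sum_single]
    rw [h1, LinearMap.sum_apply, map_sum]
    exact Finset.sum_congr rfl fun t _ => hl t (v t)
  let φ : (Fin (n + k) → T) ≃ₗ[A] ((Fin n ⊕ Fin k) → T) :=
    LinearEquiv.funCongrLeft A T finSumFinEquiv
  let ψ : ((Fin n ⊕ Fin k) → T) ≃ₗ[A] (Fin n → T) × (Fin k → T) :=
    LinearEquiv.sumArrowLequivProdArrow (Fin n) (Fin k) A T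
  suffices hS : Function.Surjective (L.coprod (N.subtype ∘ₗ g)) by
    exact ⟨n + k, (L.coprod (N.subtype ∘ₗ g)) ∘ₗ (φ.trans ψ).toLinearMap,
      hS.comp (φ.trans ψ).surjective⟩
  intro x
  obtain ⟨v, hv⟩ := hf (N.mkQ x)
  have h1 : x - L v ∈ N := by
    rw [← Submodule.Quotient.mk_eq_zero, ← Submodule.mkQ_apply, map_sub, hL, hv, sub_self]
  obtain ⟨w, hw⟩ := hg ⟨x - L v, h1⟩
  refine ⟨(v, w), ?_⟩
  rw [LinearMap.coprod_apply, LinearMap.comp_apply, hw]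
  exact add_sub_cancel _ _

end Fac

section Rep

variable {K : Type} [Field K] {Λ : Type} [Ring Λ] [Algebra K Λ] [FiniteDimensional K Λ]
  {ι : Type} [Fintype ι] [DecidableEq ι] {e : ι → Λ}
  {Arr : ι → ι → Type} [∀ i j, Fintype (Arr i j)] {arr : ∀ i j, Arr i j → Λ}
  (C : QData K Λ e Arr arr) {i j : ι}
  {M : Type} [AddCommGroup M] [Module Λᵐᵒᵖ M] [Module K M] [IsScalarTower K Λᵐᵒᵖ M]
  {N : Type} [AddCommGroup N] [Module Λᵐᵒᵖ N] [Module K N] [IsScalarTower K Λᵐᵒᵖ N]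

/-- Between modules supported at `{i, j}` only the arrows `i → j` matter. -/
theorem exists_hom_of_suppIn (C : QData K Λ e Arr arr) (hji : IsEmpty (Arr j i)) (hM : SuppIn e i j M) (hN : SuppIn e i j N)
    (f : M →ₗ[K] N) (he : ∀ k m, f (op (e k) • m) = op (e k) • f m)
    (ha : ∀ (a : Arr i j) m, f (op (arr i j a) • m) = op (arr i j a) • f m) :
    ∃ g : M →ₗ[Λᵐᵒᵖ] N, ∀ m, g m = f m := by
  refine ⟨liftHom C (ll2_of_suppIn C hM) (ll2_of_suppIn C hN) f he fun k l a m => ?_,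
    fun m => liftHom_apply _ _ _ _ _ _ m⟩
  by_cases h1 : k = i ∧ l = j
  · obtain ⟨rfl, rfl⟩ := h1; exact ha a m
  by_cases h2 : k = j ∧ l = i
  · obtain ⟨rfl, rfl⟩ := h2; exact hji.elim a
  rw [hM.arr_smul_eq_zero C a h1 h2, hN.arr_smul_eq_zero C a h1 h2, map_zero]

theorem isNoetherianRing_op (K : Type) [Field K] (Λ : Type) [Ring Λ] [Algebra K Λ]
    [FiniteDimensional K Λ] : IsNoetherianRing Λᵐᵒᵖ :=
  have : Module.Finite K Λᵐᵒᵖ := Module.Finite.equiv (opLinearEquiv K : Λ ≃ₗ[K] Λᵐᵒᵖ)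
  IsNoetherianRing.of_finite K Λᵐᵒᵖ

theorem memFac_smp (k : ι) (hM : SuppIn e k k M) [Module.Finite Λᵐᵒᵖ M] :
    MemFac (ModuleCat.of Λᵐᵒᵖ (Smp C k)) (ModuleCat.of Λᵐᵒᵖ M) := by
  have hfin : Module.Finite Λᵐᵒᵖ (ModuleCat.of Λᵐᵒᵖ M) := ‹Module.Finite Λᵐᵒᵖ M›
  refine memFac_of_iSup_range (eq_top_iff.mpr fun m _ => ?_)
  change M at m
  let p : Smp C k →ₗ[K] K := LinearMap.id
  have hm : op (e k) • m = m := by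
    conv_rhs => rw [← sum_idem_smul C m]
    exact (Finset.sum_eq_single k (fun l _ hl => hM l hl hl m) (by simp)).symm
  obtain ⟨g, hg⟩ := exists_hom_of_suppIn C (i := k) (j := k) ⟨C.not_loop k⟩
    (Smp.suppIn_left C k k) hM (p.smulRight m) (fun l c => by
      rw [Smp.idem_smul, LinearMap.smulRight_apply, LinearMap.smulRight_apply, smul_comm]
      split_ifs with h
      · rw [h, hm]
      · rw [hM l h h, smul_zero, map_zero, zero_smul]) (fun a => (C.not_loop k a).elim)
  refine Submodule.mem_iSup_of_mem g ⟨Smp.one C k, ?_⟩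
  refine (hg _).trans ?_
  rw [LinearMap.smulRight_apply]
  exact one_smul K m

/-- A module over which the arrows `i → j` do not generate the space at `j` has the simple module
at `j` as a quotient. -/
theorem memFac_smp_of_not_genP (hM : SuppIn e i j M) (h : ¬ GenP e arr i j M) :
    MemFac (ModuleCat.of Λᵐᵒᵖ M) (ModuleCat.of Λᵐᵒᵖ (Smp C j)) := by
  have h1 : ∃ y : M, ∀ f : Arr i j → M, op (e j) • y ≠ ∑ a, op (arr i j a) • f a := by
    simpa only [GenP, not_forall, not_exists] using h
  obtain ⟨y, hy⟩ := h1
  let D : Submodule K M := LinearMap.range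
    (∑ a, actMap K M (arr i j a) ∘ₗ LinearMap.proj a : (Arr i j → M) →ₗ[K] M)
  have hD : ∀ z : M, z ∈ D ↔ ∃ f : Arr i j → M, z = ∑ a, op (arr i j a) • f a := by
    intro z
    simp only [D, LinearMap.mem_range, LinearMap.sum_apply, LinearMap.comp_apply,
      LinearMap.proj_apply, actMap_apply, eq_comm]
  have hyD : op (e j) • y ∉ D := by
    rw [hD]; rintro ⟨f, hf⟩; exact hy f hf
  obtain ⟨l, hl, hlD⟩ := Submodule.exists_le_ker_of_notMem hyD
  let q : K →ₗ[K] Smp C j := LinearMap.id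
  let φ : M →ₗ[K] Smp C j := q ∘ₗ l ∘ₗ actMap K M (e j)
  have hφ : ∀ m, φ m = q (l (op (e j) • m)) := fun m => rfl
  let g := liftHom C (ll2_of_suppIn C hM) (ll2_of_suppIn C (Smp.suppIn_right C j i)) φ
    (fun k m => by
      rw [hφ, hφ, Smp.idem_smul, idem_smul_idem_smul C]
      by_cases hk : k = j
      · rw [if_pos hk, if_pos hk.symm]
      · rw [if_neg hk, if_neg (Ne.symm hk), map_zero, map_zero])
    (fun k k' a m => by
      rw [hφ, Smp.arr_smul, idem_smul_arr_smul C]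
      split_ifs with hk
      · have h2 : op (arr k k' a) • m ∈ D := by
          subst hk
          by_cases hk : k = i
          · subst hk
            classical
            rw [hD]
            refine ⟨Pi.single a m, ?_⟩
            rw [Finset.sum_eq_single a (fun b _ hb => by simp [hb]) (by simp), Pi.single_eq_same]
          · rw [hM.arr_smul_eq_zero C a (fun h => hk h.1)
              (fun h => C.not_loop k (by obtain ⟨rfl, -⟩ := h; exact a))]
            exact D.zero_mem
        have h3 := hlD h2
        rw [LinearMap.mem_ker] at h3
        rw [h3, map_zero]
      · rw [map_zero, map_zero])
  have hg : ∀ m, g m = φ m := fun m => liftHom_apply _ _ _ _ _ _ m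
  refine memFac_of_surjective g fun c => ?_
  change Smp C j at c
  let c' : K := c
  refine ⟨(c' / l (op (e j) • y)) • y, ?_⟩
  refine (hg _).trans ?_
  rw [map_smul, hφ]
  exact div_mul_cancel₀ c' hl

theorem memFac_of_memFac_smp (hij : i ≠ j) (hji : IsEmpty (Arr j i)) {U : Mdl Λᵐᵒᵖ}
    (hU : IsTauRigid U) (hi : MemFac U (ModuleCat.of Λᵐᵒᵖ (Smp C i)))
    (hj : MemFac U (ModuleCat.of Λᵐᵒᵖ (Smp C j))) (hM : SuppIn e i j M)
    [Module.Finite Λᵐᵒᵖ M] : MemFac U (ModuleCat.of Λᵐᵒᵖ M) := by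
  have := isNoetherianRing_op K Λ
  let P : Submodule Λᵐᵒᵖ M := liftSub C (ll2_of_suppIn C hM) (LinearMap.ker (actMap K M (e i)))
    (fun k m hm => by
      rw [LinearMap.mem_ker, actMap_apply] at hm ⊢
      rw [idem_smul_idem_smul C, hm, ite_self])
    (fun k l a m hm => by
      rw [LinearMap.mem_ker, actMap_apply] at hm ⊢
      rw [idem_smul_arr_smul C]
      split_ifs with hl
      · exact hM.arr_smul_eq_zero C a (fun h => hij (hl.trans h.2))
          (fun h => hji.elim (by obtain ⟨rfl, rfl⟩ := h; exact a)) m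
      · rfl)
  have hP : ∀ m, m ∈ P ↔ op (e i) • m = 0 := fun m => Iff.rfl
  refine hU.memFac_of_submodule (X := ModuleCat.of Λᵐᵒᵖ M) P ?_ ?_
  · have hs : SuppIn e j j P := fun k hk _ m => Subtype.ext (by
      change op (e k) • m.1 = 0
      by_cases hki : k = i
      · rw [hki]; exact m.2
      · exact hM k hki hk m.1)
    exact hj.trans (memFac_smp C j hs)
  · have hs : SuppIn e i i (M ⧸ P) := by
      intro k hk _ m
      obtain ⟨m, rfl⟩ := P.mkQ_surjective m
      rw [← map_smul, Submodule.mkQ_apply, Submodule.Quotient.mk_eq_zero, hP,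
        idem_smul_idem_smul C, if_neg (Ne.symm hk)]
    exact hi.trans (memFac_smp C i hs)

theorem exists_memFac_smp (T : Mdl Λᵐᵒᵖ) [Module.Finite Λᵐᵒᵖ T] [Nontrivial T] :
    ∃ k, MemFac T (ModuleCat.of Λᵐᵒᵖ (Smp C k)) := by
  obtain ⟨P, hP, -⟩ := (eq_top_or_exists_le_coatom (⊥ : Submodule Λᵐᵒᵖ T)).resolve_left
    bot_ne_top
  have hS : IsSimpleModule Λᵐᵒᵖ (T ⧸ P) := isSimpleModule_iff_isCoatom.mpr hP
  have hnt : Nontrivial (T ⧸ P) := IsSimpleModule.nontrivial Λᵐᵒᵖ _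
  have hrad : ∀ x ∈ radK K Λ, ∀ s : T ⧸ P, op x • s = 0 := by
    classical
    obtain ⟨n, hn⟩ := radK_pow_eq_bot K Λ
    have hex : ∃ n, ∀ x ∈ radK K Λ ^ n, ∀ s : T ⧸ P, op x • s = 0 := ⟨n, fun x hx s => by
      rw [hn, Submodule.mem_bot] at hx
      rw [hx, op_zero, zero_smul]⟩
    obtain ⟨s₀, hs₀⟩ := exists_ne (0 : T ⧸ P)
    have h0 : Nat.find hex ≠ 0 := by
      intro h
      have h1 := Nat.find_spec hex
      rw [h, pow_zero] at h1
      refine hs₀ ?_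
      have := h1 1 (Submodule.one_le.mp le_rfl) s₀
      rwa [op_one, one_smul] at this
    obtain ⟨k, hk⟩ := Nat.exists_eq_succ_of_ne_zero h0
    have h1 := Nat.find_min hex (m := k) (by omega)
    push Not at h1
    obtain ⟨y, hy, t, ht⟩ := h1
    have h2 := Nat.find_spec hex
    rw [hk, Nat.succ_eq_add_one, pow_succ] at h2
    intro x hx s
    obtain ⟨a, ha⟩ := IsSimpleModule.toSpanSingleton_surjective Λᵐᵒᵖ ht s
    rw [← ha, LinearMap.toSpanSingleton_apply, ← op_unop a, ← mul_smul, ← mul_smul, ← op_mul,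
      ← op_mul]
    exact h2 _ (Submodule.mul_mem_mul hy (radK_mul_mem_left _ hx)) t
  let _ : Module K (T ⧸ P) := Module.compHom _ (algebraMap K Λᵐᵒᵖ)
  have : IsScalarTower K Λᵐᵒᵖ (T ⧸ P) := IsScalarTower.of_algebraMap_smul fun _ _ => rfl
  have hLL : LL2 K (Λ := Λ) (T ⧸ P) := fun x hx => hrad x (radSq_le K Λ hx)
  obtain ⟨s, hs⟩ := exists_ne (0 : T ⧸ P)
  obtain ⟨k, hk⟩ : ∃ k, op (e k) • s ≠ 0 := by
    by_contra! h
    exact hs (by rw [← sum_idem_smul C s, Finset.sum_eq_zero fun k _ => h k])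
  let p : Smp C k →ₗ[K] K := LinearMap.id
  let g := liftHom C (ll2_of_suppIn C (Smp.suppIn_left C k k)) hLL (p.smulRight (op (e k) • s))
    (fun l c => by
      rw [Smp.idem_smul, LinearMap.smulRight_apply, LinearMap.smulRight_apply, smul_comm (op (e l)) (p c),
        idem_smul_idem_smul C]
      split_ifs with h
      · rw [h]
      · rw [smul_zero, map_zero, zero_smul])
    (fun l l' a c => by
      rw [Smp.arr_smul, map_zero, hrad _ (C.pres.2.2.1 l l' a).1])
  have hg : ∀ c, g c = p c • op (e k) • s := fun c => rfl
  have hinj : Function.Injective g := by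
    rw [injective_iff_map_eq_zero]
    intro c hc
    rw [hg] at hc
    exact (smul_eq_zero.mp hc).resolve_right hk
  have hsurj : Function.Surjective g := by
    rw [← LinearMap.range_eq_top]
    refine (eq_bot_or_eq_top (LinearMap.range g)).resolve_left fun h => ?_
    rw [LinearMap.range_eq_bot] at h
    have h1 := hg (Smp.one C k)
    rw [h, LinearMap.zero_apply] at h1
    exact hk (h1.trans (one_smul K _)).symm
  let φ := LinearEquiv.ofBijective g ⟨hinj, hsurj⟩
  exact ⟨k, memFac_of_surjective (φ.symm.toLinearMap ∘ₗ P.mkQ)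
    (φ.symm.surjective.comp P.mkQ_surjective)⟩

end Rep

section Proj

variable {K : Type} [Field K] {Λ : Type} [Ring Λ] [Algebra K Λ] [FiniteDimensional K Λ]
  {ι : Type} [Fintype ι] [DecidableEq ι] {e : ι → Λ}
  {Arr : ι → ι → Type} [∀ i j, Fintype (Arr i j)] {arr : ∀ i j, Arr i j → Λ}
  (C : QData K Λ e Arr arr) {i j : ι}
  {M : Type} [AddCommGroup M] [Module Λᵐᵒᵖ M] [Module K M] [IsScalarTower K Λᵐᵒᵖ M]

theorem not_genP_of_isEmpty (hA : IsEmpty (Arr i j)) (hj : ∃ m : M, op (e j) • m ≠ 0) :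
    ¬ GenP e arr i j M := by
  intro h
  obtain ⟨m, hm⟩ := hj
  obtain ⟨f, hf⟩ := h m
  exact hm (hf.trans (Fintype.sum_empty _))

theorem arr_smul_arr_smul (C : QData K Λ e Arr arr) (hij : i ≠ j) (a b : Arr i j) (m : M) :
    op (arr i j a) • op (arr i j b) • m = 0 := by
  have h1 := idem_smul_arr_smul C b j m
  rw [if_pos rfl] at h1
  rw [← h1, arr_smul_idem_smul C, if_neg hij.symm]

variable [∀ i j, DecidableEq (Arr i j)]

theorem memFac_pKr (hij : i ≠ j) (hji : IsEmpty (Arr j i)) (hM : SuppIn e i j M)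
    (hg : GenP e arr i j M) [Module.Finite Λᵐᵒᵖ M] :
    MemFac (ModuleCat.of Λᵐᵒᵖ (PKr C i j)) (ModuleCat.of Λᵐᵒᵖ M) := by
  have hfin : Module.Finite Λᵐᵒᵖ (ModuleCat.of Λᵐᵒᵖ M) := ‹Module.Finite Λᵐᵒᵖ M›
  have key : ∀ m : M, ∃ g : PKr C i j →ₗ[Λᵐᵒᵖ] M, ∀ v w,
      g (Kr.mk C _ v w) = v • op (e i) • m + ∑ a, w a • op (arr i j a) • m := by
    intro m
    let F : K × (Arr i j → K) →ₗ[K] M := LinearMap.coprod (LinearMap.id.smulRight (op (e i) • m))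
      (∑ a, (LinearMap.proj a : (Arr i j → K) →ₗ[K] K).smulRight (op (arr i j a) • m))
    let f : PKr C i j →ₗ[K] M := F
    have hf : ∀ v w, f (Kr.mk C _ v w) = v • op (e i) • m + ∑ a, w a • op (arr i j a) • m := by
      intro v w
      refine (LinearMap.coprod_apply _ _ _).trans ?_
      simp [Kr.mk]
    obtain ⟨g, hg⟩ := exists_hom_of_suppIn C hji (Kr.suppIn C _) hM f
      (fun k x => by
        obtain ⟨v, w, rfl⟩ := Kr.exists_mk C _ x
        rw [Kr.idem_smul, hf, hf, smul_add, smul_comm (op (e k)) v, Finset.smul_sum,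
          idem_smul_idem_smul C]
        congr 1
        · split_ifs with h1
          · rw [h1]
          · rw [zero_smul, smul_zero]
        · refine Finset.sum_congr rfl fun a _ => ?_
          rw [smul_comm (op (e k)) (w a), idem_smul_arr_smul C]
          split_ifs with h1
          · rfl
          · rw [Pi.zero_apply, zero_smul, smul_zero])
      (fun a x => by
        obtain ⟨v, w, rfl⟩ := Kr.exists_mk C _ x
        rw [Kr.arr_smul, hf, hf, zero_smul, zero_add, smul_add, smul_comm _ v, Finset.smul_sum,
          arr_smul_idem_smul C, if_pos rfl, Finset.sum_eq_single a _ (by simp),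
          Finset.sum_eq_zero, add_zero]
        · simp [projArr]
        · intro b _
          rw [smul_comm _ (w b), arr_smul_arr_smul C hij, smul_zero]
        · intro b _ hb
          simp [projArr, hb])
    exact ⟨g, fun v w => (hg _).trans (hf v w)⟩
  refine memFac_of_iSup_range (eq_top_iff.mpr fun m _ => ?_)
  change M at m
  have h1 : m = op (e i) • m + op (e j) • m := by
    conv_lhs => rw [← sum_idem_smul C m]
    exact Fintype.sum_eq_add i j hij fun k hk => hM k hk.1 hk.2 m
  obtain ⟨f, hf⟩ := hg m
  rw [h1, hf]
  refine add_mem ?_ (sum_mem fun a _ => ?_)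
  · obtain ⟨g, hg⟩ := key m
    refine Submodule.mem_iSup_of_mem g ⟨Kr.mk C _ 1 0, (hg _ _).trans ?_⟩
    simp
  · obtain ⟨g, hg⟩ := key (f a)
    refine Submodule.mem_iSup_of_mem g ⟨Kr.mk C _ 0 (Pi.single a 1), (hg _ _).trans ?_⟩
    rw [zero_smul, zero_add, Finset.sum_eq_single a (fun b _ hb => by simp [hb]) (by simp),
      Pi.single_eq_same, one_smul]

theorem memFac_pKr_of_subsingleton (hij : i ≠ j) (hji : IsEmpty (Arr j i)) [Subsingleton (Arr i j)]
    (a : Arr i j) (hM : SuppIn e i j M) (hg : GenP e arr i j M)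
    (hj : ∃ m : M, op (e j) • m ≠ 0) :
    MemFac (ModuleCat.of Λᵐᵒᵖ M) (ModuleCat.of Λᵐᵒᵖ (PKr C i j)) := by
  obtain ⟨y, hy⟩ := hj
  obtain ⟨F, hF⟩ := hg y
  have hF' : op (e j) • y = op (arr i j a) • F a := by
    rw [hF]
    exact Finset.sum_eq_single a (fun b _ hb => absurd (Subsingleton.elim _ _) hb) (by simp)
  obtain ⟨φ, hφ, -⟩ := Submodule.exists_le_ker_of_notMem (p := (⊥ : Submodule K M)) hy
  let F' : M →ₗ[K] K × (Arr i j → K) := LinearMap.prod (φ ∘ₗ actMap K M (arr i j a))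
    (LinearMap.single K (fun _ => K) a ∘ₗ φ ∘ₗ actMap K M (e j))
  let f : M →ₗ[K] PKr C i j := F'
  have hf : ∀ t, f t = Kr.mk C _ (φ (op (arr i j a) • t)) (Pi.single a (φ (op (e j) • t))) :=
    fun t => rfl
  obtain ⟨g, hg⟩ := exists_hom_of_suppIn C hji hM (Kr.suppIn C _) f
    (fun k t => by
      rw [hf, hf, Kr.idem_smul, arr_smul_idem_smul C, idem_smul_idem_smul C]
      congr 1
      · split_ifs
        · rfl
        · rw [map_zero]
      · by_cases h : k = j
        · rw [if_pos h.symm, if_pos h]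
        · rw [if_neg (Ne.symm h), if_neg h, map_zero, Pi.single_zero])
    (fun b t => by
      rw [Subsingleton.elim b a, hf, hf, Kr.arr_smul, arr_smul_arr_smul C hij, map_zero,
        idem_smul_arr_smul C, if_pos rfl]
      rfl)
  refine memFac_of_surjective g fun x => ?_
  change PKr C i j at x
  obtain ⟨v, w, rfl⟩ := Kr.exists_mk C _ x
  let c := φ (op (e j) • y)
  refine ⟨(v / c) • op (e i) • F a + (w a / c) • op (e j) • y, (hg _).trans ?_⟩
  have h1 : op (arr i j a) • op (e j) • y = 0 := by
    rw [arr_smul_idem_smul C, if_neg hij.symm]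
  rw [map_add, map_smul f (v / c), map_smul f (w a / c), hf, hf, h1, arr_smul_idem_smul C, if_pos rfl, ← hF',
    idem_smul_idem_smul C, if_neg hij.symm, idem_smul_idem_smul C, if_pos rfl, map_zero,
    Pi.single_zero, Kr.smul_mk, Kr.smul_mk, ← Kr.mk_add, Kr.mk_inj]
  constructor
  · rw [smul_zero, add_zero]
    exact div_mul_cancel₀ v hφ
  · rw [smul_zero, zero_add]
    funext b
    rw [Subsingleton.elim b a, Pi.smul_apply, Pi.single_eq_same]
    exact div_mul_cancel₀ (w a) hφ

end Proj

section Poset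

variable {A B : Type} [Ring A] [Ring B] {PA : Mdl A → Prop} {PB : Mdl B → Prop}

/-- `T` is minimal among the non-minimum elements of the poset of modules satisfying `P`. -/
def IsAtomOf (P : Mdl A → Prop) (T : Mdl A) : Prop :=
  P T ∧ ¬ IsMinOf P T ∧ ∀ U, P U → FacLE U T → FacLE T U ∨ IsMinOf P U

/-- `T` lies strictly above `X`, not above `Y`, and below every common upper bound of `X`
and `Y`. -/
def IsBetween (P : Mdl A → Prop) (X Y T : Mdl A) : Prop :=
  P T ∧ FacLE X T ∧ ¬ FacLE T X ∧ ¬ FacLE Y T ∧ ∀ U, P U → FacLE X U → FacLE Y U → FacLE T U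

namespace PosetIsoP

/-- The inverse of a poset isomorphism. -/
def symm (ρ : PosetIsoP PA PB) : PosetIsoP PB PA where
  toFun := ρ.invFun
  invFun := ρ.toFun
  maps := ρ.maps'
  maps' := ρ.maps
  le_iff := ρ.le_iff'
  le_iff' := ρ.le_iff
  left_inv := ρ.right_inv
  right_inv := ρ.left_inv

variable (ρ : PosetIsoP PA PB)

theorem toFun_le_iff {M : Mdl A} {N : Mdl B} (hM : PA M) (hN : PB N) :
    FacLE (ρ.toFun M) N ↔ FacLE M (ρ.invFun N) := by
  rw [ρ.le_iff' _ _ (ρ.maps M hM) hN]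
  exact ⟨(ρ.left_inv M hM).2.trans, (ρ.left_inv M hM).1.trans⟩

theorem le_toFun_iff {M : Mdl A} {N : Mdl B} (hM : PA M) (hN : PB N) :
    FacLE N (ρ.toFun M) ↔ FacLE (ρ.invFun N) M := by
  rw [ρ.le_iff' _ _ hN (ρ.maps M hM)]
  exact ⟨fun h => h.trans (ρ.left_inv M hM).1, fun h => h.trans (ρ.left_inv M hM).2⟩

theorem isMinOf_iff {T : Mdl A} (hT : PA T) : IsMinOf PB (ρ.toFun T) ↔ IsMinOf PA T := by
  constructor
  · exact fun h => ⟨hT, fun S hS => (ρ.le_iff T S hT hS).mpr (h.2 _ (ρ.maps S hS))⟩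
  · exact fun h => ⟨ρ.maps T hT, fun S hS => (ρ.toFun_le_iff hT hS).mpr (h.2 _ (ρ.maps' S hS))⟩

theorem isAtomOf {T : Mdl A} (h : IsAtomOf PA T) : IsAtomOf PB (ρ.toFun T) := by
  obtain ⟨hT, hmin, hU⟩ := h
  refine ⟨ρ.maps T hT, fun h => hmin ((ρ.isMinOf_iff hT).mp h), fun U hPU hle => ?_⟩
  refine (hU _ (ρ.maps' U hPU) ((ρ.le_toFun_iff hT hPU).mp hle)).imp ?_ ?_
  · exact (ρ.toFun_le_iff hT hPU).mpr
  · exact (ρ.symm.isMinOf_iff hPU).mp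

theorem isBetween {X Y T : Mdl A} {X' Y' : Mdl B} (hX : PA X) (hY : PA Y)
    (hX' : PE (ρ.toFun X) X') (hY' : PE (ρ.toFun Y) Y') (h : IsBetween PA X Y T) :
    IsBetween PB X' Y' (ρ.toFun T) := by
  obtain ⟨hT, h1, h2, h3, h4⟩ := h
  refine ⟨ρ.maps T hT, hX'.2.trans ((ρ.le_iff _ _ hX hT).mp h1),
    fun h => h2 ((ρ.le_iff _ _ hT hX).mpr (h.trans hX'.2)),
    fun h => h3 ((ρ.le_iff _ _ hY hT).mpr (hY'.1.trans h)), fun U hU hXU hYU => ?_⟩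
  exact (ρ.toFun_le_iff hT hU).mpr (h4 _ (ρ.maps' U hU)
    ((ρ.toFun_le_iff hX hU).mp (hX'.1.trans hXU)) ((ρ.toFun_le_iff hY hU).mp (hY'.1.trans hYU)))

end PosetIsoP

end Poset

section Atoms

variable {K : Type} [Field K] {Λ : Type} [Ring Λ] [Algebra K Λ] [FiniteDimensional K Λ]
  {ι : Type} [Fintype ι] [DecidableEq ι] {e : ι → Λ}
  {Arr : ι → ι → Type} [∀ i j, Fintype (Arr i j)] {arr : ∀ i j, Arr i j → Λ}
  (C : QData K Λ e Arr arr) {i j : ι}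

/-- The simple module at the vertex `k`, as an object of the module category. -/
noncomputable abbrev SmpMdl (k : ι) : Mdl Λᵐᵒᵖ := ModuleCat.of Λᵐᵒᵖ (Smp C k)

theorem isMinOf_isBSTT_iff {T : Mdl Λᵐᵒᵖ} (hT : IsBSTT Λ e T) :
    IsMinOf (IsBSTT Λ e) T ↔ Subsingleton T := by
  constructor
  · intro h
    have hs : Subsingleton (ModuleCat.of Λᵐᵒᵖ PUnit.{1}) :=
      inferInstanceAs (Subsingleton PUnit)
    exact subsingleton_of_memFac (facLE_iff.mp (h.2 _ (isBSTT_of_subsingleton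
      (ModuleCat.of Λᵐᵒᵖ PUnit.{1}))))
  · exact fun h => ⟨hT, fun S _ => facLE_iff.mpr memFac_of_subsingleton⟩

theorem eq_of_facLE_smp {k l : ι} (h : FacLE (SmpMdl C k) (SmpMdl C l)) : k = l := by
  have h1 : SuppIn e l l (Smp C k) :=
    SuppIn.of_memFac (M := SmpMdl C l) (X := SmpMdl C k) (Smp.suppIn_left C l l) (facLE_iff.mp h)
  obtain ⟨m, hm⟩ := Smp.exists_idem_smul_ne_zero C k
  by_contra hkl
  exact hm (h1 k hkl hkl m)

theorem not_isMinOf_smp (k : ι) : ¬ IsMinOf (IsBSTT Λ e) (SmpMdl C k) := by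
  rw [isMinOf_isBSTT_iff (Smp.isBSTT C k)]
  exact fun h => Smp.one_ne_zero C k (h.elim _ _)

theorem exists_smp_le {T : Mdl Λᵐᵒᵖ} (hT : IsBSTT Λ e T) (h : ¬ IsMinOf (IsBSTT Λ e) T) :
    ∃ k, FacLE (SmpMdl C k) T := by
  rw [isMinOf_isBSTT_iff hT, not_subsingleton_iff_nontrivial] at h
  have hfin := hT.1.1
  obtain ⟨k, hk⟩ := exists_memFac_smp C T
  exact ⟨k, facLE_iff.mpr hk⟩

theorem isAtomOf_smp (k : ι) : IsAtomOf (IsBSTT Λ e) (SmpMdl C k) := by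
  refine ⟨Smp.isBSTT C k, not_isMinOf_smp C k, fun U hU hle => ?_⟩
  refine (em (IsMinOf (IsBSTT Λ e) U)).symm.imp (fun h => ?_) id
  obtain ⟨l, hl⟩ := exists_smp_le C hU h
  rwa [eq_of_facLE_smp C (hl.trans hle)] at hl

theorem IsAtomOf.exists_smp {T : Mdl Λᵐᵒᵖ} (h : IsAtomOf (IsBSTT Λ e) T) :
    ∃ k, PE T (SmpMdl C k) := by
  obtain ⟨k, hk⟩ := exists_smp_le C h.1 h.2.1
  exact ⟨k, (h.2.2 _ (Smp.isBSTT C k) hk).resolve_right (not_isMinOf_smp C k), hk⟩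

/-- An isomorphism of support `τ`-tilting posets permutes the simple modules. -/
theorem exists_equiv_smp {Γ : Type} [Ring Γ] [Algebra K Γ] [FiniteDimensional K Γ]
    {ι' : Type} [Fintype ι'] [DecidableEq ι'] {f : ι' → Γ}
    {Arr' : ι' → ι' → Type} [∀ i j, Fintype (Arr' i j)] {arr' : ∀ i j, Arr' i j → Γ}
    (C' : QData K Γ f Arr' arr') (ρ : PosetIsoP (IsBSTT Λ e) (IsBSTT Γ f)) :
    ∃ σ : ι ≃ ι', ∀ k, PE (ρ.toFun (SmpMdl C k)) (SmpMdl C' (σ k)) := by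
  choose σ hσ using fun k => (ρ.isAtomOf (isAtomOf_smp C k)).exists_smp C'
  choose τ hτ using fun k => (ρ.symm.isAtomOf (isAtomOf_smp C' k)).exists_smp C
  refine ⟨⟨σ, τ, fun k => ?_, fun k => ?_⟩, hσ⟩
  · exact eq_of_facLE_smp C ((hτ (σ k)).2.trans
      ((ρ.le_toFun_iff (Smp.isBSTT C k) (Smp.isBSTT C' _)).mp (hσ k).2))
  · exact eq_of_facLE_smp C' ((hσ (τ k)).2.trans
      ((ρ.symm.le_toFun_iff (Smp.isBSTT C' k) (Smp.isBSTT C _)).mp (hτ k).2))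

end Atoms

section Arrows

variable {K : Type} [Field K] {Λ : Type} [Ring Λ] [Algebra K Λ] [FiniteDimensional K Λ]
  {ι : Type} [Fintype ι] [DecidableEq ι] {e : ι → Λ}
  {Arr : ι → ι → Type} [∀ i j, Fintype (Arr i j)] {arr : ∀ i j, Arr i j → Λ}
  (C : QData K Λ e Arr arr) {i j : ι}

theorem smp_le_of_not_genP {T : Mdl Λᵐᵒᵖ} (hs : SuppIn e i j T) (h : ¬ GenP e arr i j T) :
    FacLE (SmpMdl C j) T := by
  let _ : Module K T := Module.compHom T (algebraMap K Λᵐᵒᵖ)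
  have : IsScalarTower K Λᵐᵒᵖ T := IsScalarTower.of_algebraMap_smul fun _ _ => rfl
  exact facLE_iff.mpr (memFac_smp_of_not_genP C hs h)

theorem exists_idem_smul_ne_zero {T : Mdl Λᵐᵒᵖ} [Module.Finite Λᵐᵒᵖ T] (hs : SuppIn e i j T)
    (h : ¬ FacLE T (SmpMdl C i)) : ∃ m : T, op (e j) • m ≠ 0 := by
  let _ : Module K T := Module.compHom T (algebraMap K Λᵐᵒᵖ)
  have : IsScalarTower K Λᵐᵒᵖ T := IsScalarTower.of_algebraMap_smul fun _ _ => rfl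
  by_contra! h1
  refine h (facLE_iff.mpr (memFac_smp C i fun k hk _ m => ?_))
  by_cases hkj : k = j
  · rw [hkj, h1]
  · exact hs k hk hkj m

theorem not_le_smp (hij : i ≠ j) {T : Mdl Λᵐᵒᵖ} (hj : ∃ m : T, op (e j) • m ≠ 0) :
    ¬ FacLE T (SmpMdl C i) := by
  intro h
  obtain ⟨m, hm⟩ := hj
  have h1 : SuppIn e i i T :=
    SuppIn.of_memFac (M := SmpMdl C i) (Smp.suppIn_left C i i) (facLE_iff.mp h)
  exact hm (h1 j hij.symm hij.symm m)

theorem le_of_smp_le (hij : i ≠ j) (hji : IsEmpty (Arr j i)) {T U : Mdl Λᵐᵒᵖ}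
    (hT : IsBSTT Λ e T) (hs : SuppIn e i j T) (hU : IsBSTT Λ e U) (hi : FacLE (SmpMdl C i) U)
    (hj : FacLE (SmpMdl C j) U) : FacLE T U := by
  let _ : Module K T := Module.compHom T (algebraMap K Λᵐᵒᵖ)
  have : IsScalarTower K Λᵐᵒᵖ T := IsScalarTower.of_algebraMap_smul fun _ _ => rfl
  have hfin := hT.1.1
  exact facLE_iff.mpr (memFac_of_memFac_smp C hij hji hU.1.2.1 (facLE_iff.mp hi)
    (facLE_iff.mp hj) hs)

variable [∀ i j, DecidableEq (Arr i j)]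

theorem exists_upper_bound_of_isEmpty (hij : i ≠ j) (hji : IsEmpty (Arr j i)) :
    ∃ U, IsBSTT Λ e U ∧ SuppIn e i j U ∧ FacLE (SmpMdl C i) U ∧ FacLE (SmpMdl C j) U := by
  have hs : SuppIn e i j (PKr C i j × Smp C j) :=
    (Kr.suppIn C _).prod (Smp.suppIn_right C j i)
  refine ⟨_, isBSTT_pKr_smp C hij hji, hs, ?_, ?_⟩
  · refine smp_le_of_not_genP C hs.symm (not_genP_of_isEmpty hji ⟨(Kr.mk C _ 1 0, 0), fun h => ?_⟩)
    have h1 := congrArg Prod.fst h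
    change op (e i) • Kr.mk C _ 1 0 = 0 at h1
    rw [Kr.idem_smul, if_pos rfl, ← Kr.mk_zero, Kr.mk_inj] at h1
    exact one_ne_zero h1.1
  · exact facLE_iff.mpr (memFac_of_surjective (LinearMap.snd Λᵐᵒᵖ (PKr C i j) (Smp C j))
      Prod.snd_surjective)

theorem exists_upper_bound (hij : i ≠ j) :
    ∃ U, IsBSTT Λ e U ∧ SuppIn e i j U ∧ FacLE (SmpMdl C i) U ∧ FacLE (SmpMdl C j) U := by
  by_cases hji : IsEmpty (Arr j i)
  · exact exists_upper_bound_of_isEmpty C hij hji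
  · rw [not_isEmpty_iff] at hji
    obtain ⟨a⟩ := hji
    obtain ⟨U, h1, h2, h3, h4⟩ :=
      exists_upper_bound_of_isEmpty C hij.symm ⟨fun b => C.not_cycle i j b a⟩
    exact ⟨U, h1, h2.symm, h4, h3⟩

theorem IsBetween.ne {T : Mdl Λᵐᵒᵖ} (h : IsBetween (IsBSTT Λ e) (SmpMdl C i) (SmpMdl C j) T) :
    i ≠ j := by
  rintro rfl
  exact h.2.2.2.1 h.2.1

theorem IsBetween.suppIn {T : Mdl Λᵐᵒᵖ}
    (h : IsBetween (IsBSTT Λ e) (SmpMdl C i) (SmpMdl C j) T) : SuppIn e i j T := by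
  obtain ⟨U, h1, h2, h3, h4⟩ := exists_upper_bound C h.ne
  exact h2.of_memFac (facLE_iff.mp (h.2.2.2.2 U h1 h3 h4))

theorem IsBetween.exists_idem_smul_ne_zero {T : Mdl Λᵐᵒᵖ}
    (h : IsBetween (IsBSTT Λ e) (SmpMdl C i) (SmpMdl C j) T) : ∃ m : T, op (e j) • m ≠ 0 :=
  have := h.1.1.1
  TauTilting.exists_idem_smul_ne_zero C h.suppIn h.2.2.1

theorem IsBetween.genP {T : Mdl Λᵐᵒᵖ}
    (h : IsBetween (IsBSTT Λ e) (SmpMdl C i) (SmpMdl C j) T) : GenP e arr i j T := by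
  by_contra hg
  exact h.2.2.2.1 (smp_le_of_not_genP C h.suppIn hg)

theorem isBetween_smp_iKr (a : Arr i j) : IsBetween (IsBSTT Λ e) (SmpMdl C i) (SmpMdl C j)
    (ModuleCat.of Λᵐᵒᵖ (Smp C i × IKr C i j)) := by
  have hij : i ≠ j := by
    rintro rfl
    exact C.not_loop i a
  have hji : IsEmpty (Arr j i) := ⟨C.not_cycle i j a⟩
  have hne : Nonempty (Arr i j) := ⟨a⟩
  have hT := isBSTT_smp_iKr C hij hji
  have hs : SuppIn e i j (Smp C i × IKr C i j) := (Smp.suppIn_left C i j).prod (Kr.suppIn C _)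
  refine ⟨hT, facLE_iff.mpr (memFac_of_surjective (LinearMap.fst Λᵐᵒᵖ (Smp C i) (IKr C i j))
    Prod.fst_surjective), not_le_smp C hij ⟨(0, Kr.mk C _ 0 1), fun h => ?_⟩, fun h => ?_,
    fun U hU => le_of_smp_le C hij hji hT hs hU⟩
  · have h1 := congrArg Prod.snd h
    change op (e j) • Kr.mk C _ 0 1 = 0 at h1
    rw [Kr.idem_smul, if_pos rfl, ← Kr.mk_zero, Kr.mk_inj] at h1
    exact one_ne_zero h1.2
  · exact Smp.not_injP C i j a (InjP.of_memFac (X := SmpMdl C j)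
      (((Smp.injP C i j hij).prod (IKr.injP C hij))) (facLE_iff.mp h))

theorem isBetween_pKr_cKr (a : Arr i j) : IsBetween (IsBSTT Λ e) (SmpMdl C i) (SmpMdl C j)
    (ModuleCat.of Λᵐᵒᵖ (PKr C i j × CKr C i j)) := by
  have hij : i ≠ j := by
    rintro rfl
    exact C.not_loop i a
  have hji : IsEmpty (Arr j i) := ⟨C.not_cycle i j a⟩
  have hT := isBSTT_pKr_cKr C hij a hji
  have hs : SuppIn e i j (PKr C i j × CKr C i j) := (Kr.suppIn C _).prod (Kr.suppIn C _)
  refine ⟨hT, smp_le_of_not_genP C hs.symm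
    (not_genP_of_isEmpty hji ⟨(Kr.mk C _ 1 0, 0), fun h => ?_⟩),
    not_le_smp C hij ⟨(Kr.mk C _ 0 (Pi.single a 1), 0), fun h => ?_⟩, fun h => ?_,
    fun U hU => le_of_smp_le C hij hji hT hs hU⟩
  · have h1 := congrArg Prod.fst h
    change op (e i) • Kr.mk C _ 1 0 = 0 at h1
    rw [Kr.idem_smul, if_pos rfl, ← Kr.mk_zero, Kr.mk_inj] at h1
    exact one_ne_zero h1.1
  · have h1 := congrArg Prod.fst h
    change op (e j) • Kr.mk C _ 0 (Pi.single a 1) = 0 at h1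
    rw [Kr.idem_smul, if_pos rfl, ← Kr.mk_zero, Kr.mk_inj, Pi.single_eq_zero_iff] at h1
    exact one_ne_zero h1.2
  · exact Smp.not_genP C i j (GenP.of_memFac (X := SmpMdl C j)
      ((PKr.genP C hij).prod (CKr.genP C hij)) (facLE_iff.mp h))

theorem nonempty_arr_iff :
    Nonempty (Arr i j) ↔ ∃ T, IsBetween (IsBSTT Λ e) (SmpMdl C i) (SmpMdl C j) T := by
  refine ⟨fun ⟨a⟩ => ⟨_, isBetween_smp_iKr C a⟩, fun ⟨T, h⟩ => ?_⟩
  by_contra hA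
  rw [not_nonempty_iff] at hA
  exact not_genP_of_isEmpty hA h.exists_idem_smul_ne_zero h.genP

theorem IsBetween.le_of_subsingleton [Subsingleton (Arr i j)] {T T' : Mdl Λᵐᵒᵖ}
    (h : IsBetween (IsBSTT Λ e) (SmpMdl C i) (SmpMdl C j) T)
    (h' : IsBetween (IsBSTT Λ e) (SmpMdl C i) (SmpMdl C j) T') : FacLE T T' := by
  obtain ⟨a⟩ := (nonempty_arr_iff C).mpr ⟨T, h⟩
  have hji : IsEmpty (Arr j i) := ⟨C.not_cycle i j a⟩
  let _ : Module K T := Module.compHom T (algebraMap K Λᵐᵒᵖ)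
  have : IsScalarTower K Λᵐᵒᵖ T := IsScalarTower.of_algebraMap_smul fun _ _ => rfl
  let _ : Module K T' := Module.compHom T' (algebraMap K Λᵐᵒᵖ)
  have : IsScalarTower K Λᵐᵒᵖ T' := IsScalarTower.of_algebraMap_smul fun _ _ => rfl
  have hfin := h.1.1.1
  exact facLE_iff.mpr ((memFac_pKr_of_subsingleton C h.ne hji a h'.suppIn h'.genP
    h'.exists_idem_smul_ne_zero).trans (memFac_pKr C h.ne hji h.suppIn h.genP))

theorem two_le_card_arr_iff : 2 ≤ Fintype.card (Arr i j) ↔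
    ∃ T T', IsBetween (IsBSTT Λ e) (SmpMdl C i) (SmpMdl C j) T ∧
      IsBetween (IsBSTT Λ e) (SmpMdl C i) (SmpMdl C j) T' ∧ ¬ FacLE T T' := by
  constructor
  · intro h
    obtain ⟨a, b, hab⟩ := Fintype.one_lt_card_iff.mp h
    have h1 := isBetween_smp_iKr C a
    refine ⟨_, _, isBetween_pKr_cKr C a, h1, fun hle => ?_⟩
    have h2 : InjP e arr i j (PKr C i j × CKr C i j) := InjP.of_memFac
      (X := ModuleCat.of Λᵐᵒᵖ (PKr C i j × CKr C i j))
      ((Smp.injP C i j h1.ne).prod (IKr.injP C h1.ne)) (facLE_iff.mp hle)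
    exact PKr.not_injP C h1.ne hab (h2.of_surjective (LinearMap.fst Λᵐᵒᵖ _ _) Prod.fst_surjective)
  · rintro ⟨T, T', h, h', hle⟩
    by_contra hc
    have hsub : Subsingleton (Arr i j) := Fintype.card_le_one_iff_subsingleton.mp (by omega)
    exact hle (h.le_of_subsingleton C h')

end Arrows

section Transport

variable {K : Type} [Field K] {Λ : Type} [Ring Λ] [Algebra K Λ] [FiniteDimensional K Λ]
  {ι : Type} [Fintype ι] [DecidableEq ι] {e : ι → Λ}
  {Arr : ι → ι → Type} [∀ i j, Fintype (Arr i j)] {arr : ∀ i j, Arr i j → Λ}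
  {Γ : Type} [Ring Γ] [Algebra K Γ] [FiniteDimensional K Γ]
  {ι' : Type} [Fintype ι'] [DecidableEq ι'] {f : ι' → Γ}
  {Arr' : ι' → ι' → Type} [∀ i j, Fintype (Arr' i j)] {arr' : ∀ i j, Arr' i j → Γ}

theorem card_arr_le_of_posetIso (C : QData K Λ e Arr arr) (C' : QData K Γ f Arr' arr')
    (ρ : PosetIsoP (IsBSTT Λ e) (IsBSTT Γ f)) {i j : ι} {i' j' : ι'}
    (hi : PE (ρ.toFun (SmpMdl C i)) (SmpMdl C' i'))
    (hj : PE (ρ.toFun (SmpMdl C j)) (SmpMdl C' j')) :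
    (1 ≤ Fintype.card (Arr i j) → 1 ≤ Fintype.card (Arr' i' j')) ∧
      (2 ≤ Fintype.card (Arr i j) → 2 ≤ Fintype.card (Arr' i' j')) := by
  classical
  have hb := fun {T} (h : IsBetween (IsBSTT Λ e) (SmpMdl C i) (SmpMdl C j) T) =>
    ρ.isBetween (Smp.isBSTT C i) (Smp.isBSTT C j) hi hj h
  constructor
  · rw [Nat.succ_le_iff, Nat.succ_le_iff, Fintype.card_pos_iff, Fintype.card_pos_iff,
      nonempty_arr_iff C, nonempty_arr_iff C']
    exact fun ⟨T, h⟩ => ⟨_, hb h⟩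
  · rw [two_le_card_arr_iff C, two_le_card_arr_iff C']
    exact fun ⟨T, T', h, h', hle⟩ =>
      ⟨_, _, hb h, hb h', fun h1 => hle ((ρ.le_iff _ _ h.1 h'.1).mpr h1)⟩

end Transport

end TauTilting

open TauTilting in
/-- Happel–Unger reconstruction. Let `Q`, `Q'` be finite
acyclic quivers over the algebraically closed field `K`, and let `Λ ≅ KQ`,
`Γ ≅ KQ'` be the corresponding (basic, hereditary, finite dimensional) path
algebras.  If `sτtilt KQ ≅ sτtilt KQ'` as posets, then the decorated quivers
`Q_dec` and `Q'_dec` are isomorphic: there is a vertex bijection `σ` preserving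
plain arrows (exactly one arrow) and decorated arrows (at least two arrows). -/
theorem statement8
    (K : Type) [Field K] [IsAlgClosed K]
    (Λ : Type) [Ring Λ] [Algebra K Λ] [FiniteDimensional K Λ]
    (ι : Type) [Fintype ι] [DecidableEq ι] (e : ι → Λ)
    (Arr : ι → ι → Type) [∀ i j, Fintype (Arr i j)] (arr : ∀ i j, Arr i j → Λ)
    (hpres : IsGabrielPres Λ K e Arr arr)
    -- `Λ` is hereditary (submodules of projectives are projective) …
    (hhered : ∀ (M : Mdl Λᵐᵒᵖ) (N : Submodule Λᵐᵒᵖ M),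
      Module.Projective Λᵐᵒᵖ M → Module.Projective Λᵐᵒᵖ N)
    -- … with acyclic quiver, i.e. `Λ ≅ KQ` for the finite acyclic quiver `Q`
    (hacyc : ∀ i (p : QPath Arr i i), p = QPath.nil i)
    (Γ : Type) [Ring Γ] [Algebra K Γ] [FiniteDimensional K Γ]
    (ι' : Type) [Fintype ι'] [DecidableEq ι'] (f : ι' → Γ)
    (Arr' : ι' → ι' → Type) [∀ i j, Fintype (Arr' i j)] (arr' : ∀ i j, Arr' i j → Γ)
    (hpres' : IsGabrielPres Γ K f Arr' arr')
    (hhered' : ∀ (M : Mdl Γᵐᵒᵖ) (N : Submodule Γᵐᵒᵖ M),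
      Module.Projective Γᵐᵒᵖ M → Module.Projective Γᵐᵒᵖ N)
    (hacyc' : ∀ i (p : QPath Arr' i i), p = QPath.nil i)
    (ρ : PosetIsoP (IsBSTT Λ e) (IsBSTT Γ f)) :
    ∃ σ : ι ≃ ι', ∀ i j : ι,
      (Fintype.card (Arr i j) = 1 ↔ Fintype.card (Arr' (σ i) (σ j)) = 1) ∧
      (2 ≤ Fintype.card (Arr i j) ↔ 2 ≤ Fintype.card (Arr' (σ i) (σ j))) := by
  classical
  obtain ⟨C⟩ := nonempty_qData hpres hacyc
  obtain ⟨C'⟩ := nonempty_qData hpres' hacyc'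
  obtain ⟨σ, hσ⟩ := exists_equiv_smp C C' ρ
  refine ⟨σ, fun i j => ?_⟩
  have hσ' : ∀ k, PE (ρ.symm.toFun (SmpMdl C' (σ k))) (SmpMdl C k) := fun k =>
    ⟨(ρ.le_toFun_iff (Smp.isBSTT C k) (Smp.isBSTT C' _)).mp (hσ k).2,
      (ρ.toFun_le_iff (Smp.isBSTT C k) (Smp.isBSTT C' _)).mp (hσ k).1⟩
  have h := card_arr_le_of_posetIso C C' ρ (hσ i) (hσ j)
  have h' := card_arr_le_of_posetIso C' C ρ.symm (hσ' i) (hσ' j)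
  omega
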